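/- Let p be a prime and ε ∈ ℤ_p^×. Let T be a positive definite half-integral ternary form whose Gram matrix A_T is ℤ_p-equivalent to H ⊕ [pε]; then there are exactly two subgroups Γ₁, Γ₂ of ℤ³ of index p on which f_T takes all values in pℤ, and we equip Γ_k with the form (1/p)·f_T|Γ_k and write o(Γ_k) for the number of X ∈ GL₃(ℤ) preserving its Gram matrix. Let S̃₁, …, S̃_g be pairwise non-ℤ-equivalent positive definite half-integral ternary forms whose Gram matrices are ℤ_p-equivalent to H ⊕ [p²ε] and ℤ_q-equivalent to p·A_T at every prime q ≠ p, such that every positive definite half-integral ternary form with these properties is ℤ-equivalent to some S̃_i (i.e., a complete set of class representatives of the genus). For each i set Λ_p(S̃_i) := {x ∈ ℤ³ : f_{S̃_i}(x+z) ≡ f_{S̃_i}(z) (mod p) for all z}, on which f_{S̃_i} takes values in p²ℤ, and λ_p(S̃_i) := (1/p²)·f_{S̃_i} restricted to Λ_p(S̃_i); also set r̃(S̃_i^p, T) := #{X ∈ M₃(ℤ) : XᵗA_T X = p·A_{S̃_i} and pX⁻¹ ∈ M₃(ℤ)}. Then for every positive integer n: (3p² − p)·r(n,T) = Σ_{i=1}^{g}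 (r̃(S̃_i^p, T)/o(S̃_i))·( (3p/2)·r(pn, S̃_i) − (p/(p−1))·r(p³n, S̃_i) ) + (1/(p−1))·( o(Γ₁)·Σ_{i : λ_p(S̃_i) ≅ (1/p)f_T|Γ₁} r(p³n, S̃_i)/o(S̃_i) + o(Γ₂)·Σ_{i : λ_p(S̃_i) ≅ (1/p)f_T|Γ₂} r(p³n, S̃_i)/o(S̃_i) ), where ≅ denotes ℤ-equivalence of the corresponding Gram matrices. -/

import Mathlib

open Matrix

noncomputable section

/-- The image of an integral matrix in the rational matrices. -/
def intMap (X : Matrix (Fin 3) (Fin 3) ℤ) : Matrix (Fin 3) (Fin 3) ℚ :=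
  X.map fun a => (a : ℚ)

/-- The value of the quadratic form with Gram matrix `A` at an integral vector `x`. -/
def qf (A : Matrix (Fin 3) (Fin 3) ℚ) (x : Fin 3 → ℤ) : ℚ :=
  (fun i => (x i : ℚ)) ⬝ᵥ A.mulVec fun i => (x i : ℚ)

/-- A rational symmetric matrix is half-integral: integral diagonal, off-diagonal in (1/2)ℤ. -/
def HalfIntegral (A : Matrix (Fin 3) (Fin 3) ℚ) : Prop :=
  (∀ i, ∃ n : ℤ, A i i = n) ∧ ∀ i j, ∃ n : ℤ, 2 * A i j = n

/-- `A` is symmetric and positive definite. -/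
def PosDef3 (A : Matrix (Fin 3) (Fin 3) ℚ) : Prop :=
  A.IsSymm ∧ ∀ x : Fin 3 → ℚ, x ≠ 0 → 0 < x ⬝ᵥ A.mulVec x

/-- `r(K, L)`: the number of representations of the form with Gram matrix `A` by the form
with Gram matrix `B`. -/
def repNum (A B : Matrix (Fin 3) (Fin 3) ℚ) : ℕ :=
  Nat.card {X : Matrix (Fin 3) (Fin 3) ℤ // (intMap X)ᵀ * B * intMap X = A}

/-- `o(L)`: the number of integral automorphs of the form with Gram matrix `A`. -/
def autNum (A : Matrix (Fin 3) (Fin 3) ℚ) : ℕ :=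
  Nat.card {X : Matrix (Fin 3) (Fin 3) ℤ // IsUnit X.det ∧ (intMap X)ᵀ * A * intMap X = A}

/-- `r(n, f)`: the number of representations of the integer `n` by the form with
Gram matrix `A`. -/
def rEval (A : Matrix (Fin 3) (Fin 3) ℚ) (n : ℤ) : ℕ :=
  Nat.card {x : Fin 3 → ℤ // qf A x = (n : ℚ)}

/-- ℤ-equivalence of Gram matrices. -/
def ZEquiv (A B : Matrix (Fin 3) (Fin 3) ℚ) : Prop :=
  ∃ X : Matrix (Fin 3) (Fin 3) ℤ, IsUnit X.det ∧ (intMap X)ᵀ * A * intMap X = B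

/-- The Watson set `Λ_p(A) = {x ∈ ℤ³ : f_A(x + z) ≡ f_A(z) (mod p) for all z ∈ ℤ³}`. -/
def LamSet (p : ℕ) (A : Matrix (Fin 3) (Fin 3) ℚ) : Set (Fin 3 → ℤ) :=
  {x | ∀ z : Fin 3 → ℤ, ∃ k : ℤ, qf A (x + z) - qf A z = (p : ℚ) * k}

/-- ℤ_q-equivalence of rational Gram matrices (inside ℚ_q). -/
def ZqEquiv (q : ℕ) [Fact q.Prime] (A B : Matrix (Fin 3) (Fin 3) ℚ) : Prop :=
  ∃ X : Matrix (Fin 3) (Fin 3) ℤ_[q], IsUnit X.det ∧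
    (X.map fun a => (a : ℚ_[q]))ᵀ * A.map (fun a => (a : ℚ_[q])) * X.map (fun a => (a : ℚ_[q]))
      = B.map fun a => (a : ℚ_[q])

/-- ℤ_q-equivalence of a rational Gram matrix to a q-adic target matrix. -/
def ZpEquivTo (q : ℕ) [Fact q.Prime] (A : Matrix (Fin 3) (Fin 3) ℚ)
    (B : Matrix (Fin 3) (Fin 3) ℚ_[q]) : Prop :=
  ∃ X : Matrix (Fin 3) (Fin 3) ℤ_[q], IsUnit X.det ∧
    (X.map fun a => (a : ℚ_[q]))ᵀ * A.map (fun a => (a : ℚ_[q])) * X.map (fun a => (a : ℚ_[q])) = B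

/-- The block diagonal matrix `H ⊕ [c]` with `H = [[0,1/2],[1/2,0]]`. -/
def Hblock (q : ℕ) [Fact q.Prime] (c : ℚ_[q]) : Matrix (Fin 3) (Fin 3) ℚ_[q] :=
  !![0, 1/2, 0; 1/2, 0, 0; 0, 0, c]

/-- `r̃(S̃^p, T)`: representations `X` of `p·A` by `B` whose cokernel is `ℤ/p ⊕ ℤ/p`,
i.e. with `p X⁻¹` integral. -/
def rtilde (p : ℕ) (A B : Matrix (Fin 3) (Fin 3) ℚ) : ℕ :=
  Nat.card {X : Matrix (Fin 3) (Fin 3) ℤ //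
    (intMap X)ᵀ * B * intMap X = (p : ℚ) • A ∧
    ∃ U : Matrix (Fin 3) (Fin 3) ℤ,
      X * U = (p : ℤ) • (1 : Matrix (Fin 3) (Fin 3) ℤ) ∧
      U * X = (p : ℤ) • (1 : Matrix (Fin 3) (Fin 3) ℤ)}

/-- `λ_p(A)` is ℤ-equivalent to `G`: for every ℤ-basis (given by the columns of `Z`) of
`Λ_p(A)`, the Gram matrix of `(1/p²)·f_A` restricted to it is ℤ-equivalent to `G`. -/
def lamEq (p : ℕ) (A G : Matrix (Fin 3) (Fin 3) ℚ) : Prop :=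
  ∀ Z : Matrix (Fin 3) (Fin 3) ℤ, (∀ x, x ∈ LamSet p A ↔ ∃ c, x = Z.mulVec c) →
    ZEquiv (((p : ℚ) ^ 2)⁻¹ • ((intMap Z)ᵀ * A * intMap Z)) G

/-- Integral `3 × 3` matrices. -/
abbrev IntMat := Matrix (Fin 3) (Fin 3) ℤ

/-- Rational `3 × 3` matrices. -/
abbrev RatMat := Matrix (Fin 3) (Fin 3) ℚ

/-- The sublattice of `ℤ³` generated by the columns of `X`. -/
def colLattice (X : IntMat) : AddSubgroup (Fin 3 → ℤ) := X.mulVecLin.range.toAddSubgroup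

lemma mem_colLattice {X : IntMat} {x : Fin 3 → ℤ} : x ∈ colLattice X ↔ ∃ c, x = X.mulVec c := by
  simp [colLattice, eq_comm]

lemma mulVec_mem_colLattice (X : IntMat) (c : Fin 3 → ℤ) : X.mulVec c ∈ colLattice X :=
  mem_colLattice.2 ⟨c, rfl⟩

lemma exists_mul_of_forall_mulVec_mem {X Y : IntMat} (h : ∀ c, X.mulVec c ∈ colLattice Y) :
    ∃ C : IntMat, X = Y * C := by
  choose C hC using fun j : Fin 3 => mem_colLattice.1 (h (Pi.single j 1))
  refine ⟨Matrix.of fun i j => C j i, ?_⟩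
  ext i j
  have := congrFun (hC j) i
  rw [Matrix.mulVec_single_one] at this
  simpa [Matrix.mul_apply, Matrix.mulVec, dotProduct] using this

lemma exists_eq_mul_of_colLattice_le {X Y : IntMat} (h : colLattice X ≤ colLattice Y) :
    ∃ C : IntMat, X = Y * C :=
  exists_mul_of_forall_mulVec_mem fun c => h (mulVec_mem_colLattice X c)

lemma mul_left_cancel_of_det_ne_zero {X A B : IntMat} (hX : X.det ≠ 0) (h : X * A = X * B) :
    A = B := by
  have h2 : X.adjugate * (X * A) = X.adjugate * (X * B) := by rw [h]
  rw [← Matrix.mul_assoc, ← Matrix.mul_assoc, Matrix.adjugate_mul, Matrix.smul_mul,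
    Matrix.smul_mul, Matrix.one_mul, Matrix.one_mul] at h2
  exact smul_right_injective _ hX h2

lemma colLattice_index {X : IntMat} (hX : X.det ≠ 0) : (colLattice X).index = X.det.natAbs := by
  have hinj : Function.Injective X.mulVecLin := mulVec_injective_of_det_ne_zero hX
  have h := Submodule.natAbs_det_equiv X.mulVecLin.range (LinearEquiv.ofInjective _ hinj)
  have h2 : (X.mulVecLin.range.subtype ∘ₗ AddMonoidHom.toIntLinearMap
      ((LinearEquiv.ofInjective _ hinj : _ ≃ₗ[ℤ] _) : _ →+ X.mulVecLin.range)) = Matrix.toLin' X := by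
    ext i j
    rfl
  rw [h2, LinearMap.det_toLin'] at h
  rw [h]
  rfl

lemma exists_colLattice_eq {N : AddSubgroup (Fin 3 → ℤ)} (hN : N.index ≠ 0) :
    ∃ X : IntMat, colLattice X = N ∧ X.det.natAbs = N.index := by
  obtain ⟨e⟩ := Int.addSubgroup_index_ne_zero_iff.1 hN
  set φ := (N.toIntSubmodule.subtype ∘ₗ AddMonoidHom.toIntLinearMap (e.symm : (Fin 3 → ℤ) →+ N)) with hφ
  have hX : colLattice (LinearMap.toMatrix' φ) = N := by
    ext x
    rw [mem_colLattice]
    simp only [LinearMap.toMatrix'_mulVec]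
    constructor
    · rintro ⟨c, rfl⟩
      exact (e.symm c).2
    · intro hx
      exact ⟨e ⟨x, hx⟩, (congrArg Subtype.val (e.symm_apply_apply ⟨x, hx⟩)).symm⟩
  refine ⟨_, hX, ?_⟩
  have h := Submodule.natAbs_det_equiv N.toIntSubmodule e.symm
  rw [LinearMap.det_toMatrix']
  exact h

/-- Two full-rank matrices with the same column lattice differ by a unimodular matrix. -/
lemma exists_unimodular_of_colLattice_eq {X Y : IntMat} (hX : X.det ≠ 0)
    (h : colLattice X = colLattice Y) : ∃ A : IntMat, IsUnit A.det ∧ Y = X * A := by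
  obtain ⟨A, hA⟩ := exists_eq_mul_of_colLattice_le h.ge
  obtain ⟨B, hB⟩ := exists_eq_mul_of_colLattice_le h.le
  refine ⟨A, ?_, hA⟩
  have h1 : A * B = 1 := by
    apply mul_left_cancel_of_det_ne_zero hX
    rw [← Matrix.mul_assoc, ← hA, ← hB, Matrix.mul_one]
  exact IsUnit.of_mul_eq_one B.det (by rw [← Matrix.det_mul, h1, Matrix.det_one])

lemma colLattice_mul_unimodular (X : IntMat) {A : IntMat} (hA : IsUnit A.det) :
    colLattice (X * A) = colLattice X := by
  ext x
  simp only [mem_colLattice]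
  constructor
  · rintro ⟨c, rfl⟩
    exact ⟨A.mulVec c, by rw [Matrix.mulVec_mulVec]⟩
  · rintro ⟨c, rfl⟩
    refine ⟨A⁻¹.mulVec c, ?_⟩
    rw [Matrix.mulVec_mulVec, Matrix.mul_assoc, Matrix.mul_nonsing_inv A hA, Matrix.mul_one]

lemma intMap_mul (X Y : IntMat) : intMap (X * Y) = intMap X * intMap Y :=
  Matrix.map_mul (f := Int.castRingHom ℚ)

lemma intMap_det (X : IntMat) : (intMap X).det = (X.det : ℚ) :=
  (RingHom.map_det (Int.castRingHom ℚ) X).symm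

lemma intMap_one : intMap 1 = 1 := by
  simp [intMap]

lemma intMap_mulVec (X : IntMat) (c : Fin 3 → ℤ) :
    (fun i => ((X.mulVec c i : ℤ) : ℚ)) = (intMap X).mulVec fun i => (c i : ℚ) := by
  ext i
  simp [Matrix.mulVec, dotProduct, intMap]

lemma qf_mulVec (A : RatMat) (X : IntMat) (c : Fin 3 → ℤ) :
    qf A (X.mulVec c) = qf ((intMap X)ᵀ * A * intMap X) c := by
  unfold qf
  rw [intMap_mulVec, ← Matrix.mulVec_mulVec, ← Matrix.mulVec_mulVec, Matrix.dotProduct_mulVec _ (intMap X)ᵀ,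
    Matrix.vecMul_transpose]

lemma qf_smul (A : RatMat) (c : ℚ) (x : Fin 3 → ℤ) : qf (c • A) x = c * qf A x := by
  simp [qf, Matrix.smul_mulVec]

lemma qf_zsmul (A : RatMat) (k : ℤ) (x : Fin 3 → ℤ) : qf A (k • x) = (k : ℚ) ^ 2 * qf A x := by
  have : (fun i => (((k • x) i : ℤ) : ℚ)) = (k : ℚ) • fun i => (x i : ℚ) := by
    ext i; simp
  unfold qf
  rw [this, Matrix.mulVec_smul, dotProduct_smul, smul_dotProduct]
  simp only [smul_eq_mul]
  ring

lemma qf_expand {A : RatMat} (hA : A.IsSymm) (x : Fin 3 → ℤ) :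
    qf A x = A 0 0 * x 0 ^ 2 + A 1 1 * x 1 ^ 2 + A 2 2 * x 2 ^ 2 + 2 * A 0 1 * x 0 * x 1 +
      2 * A 0 2 * x 0 * x 2 + 2 * A 1 2 * x 1 * x 2 := by
  have h1 := hA.apply 0 1
  have h2 := hA.apply 0 2
  have h3 := hA.apply 1 2
  simp only [qf, dotProduct, Matrix.mulVec, Fin.sum_univ_three, h1, h2, h3]
  ring

lemma halfIntegral_iff {A : RatMat} (hA : A.IsSymm) :
    HalfIntegral A ↔ ∀ x, ∃ k : ℤ, qf A x = k := by
  constructor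
  · rintro ⟨hd, ho⟩ x
    obtain ⟨a, ha⟩ := hd 0
    obtain ⟨b, hb⟩ := hd 1
    obtain ⟨c, hc⟩ := hd 2
    obtain ⟨d, hd⟩ := ho 0 1
    obtain ⟨e, he⟩ := ho 0 2
    obtain ⟨f, hf⟩ := ho 1 2
    exact ⟨a * x 0 ^ 2 + b * x 1 ^ 2 + c * x 2 ^ 2 + d * x 0 * x 1 + e * x 0 * x 2 + f * x 1 * x 2, by
      rw [qf_expand hA, ha, hb, hc, hd, he, hf]; push_cast; ring⟩
  · intro h
    have hdiag : ∀ i, ∃ n : ℤ, A i i = n := by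
      intro i
      obtain ⟨k, hk⟩ := h (Pi.single i 1)
      refine ⟨k, ?_⟩
      rw [← hk, qf_expand hA]
      fin_cases i <;> simp
    refine ⟨hdiag, ?_⟩
    have off : ∀ i j, i ≠ j → ∃ n : ℤ, 2 * A i j = n := by
      intro i j hij
      obtain ⟨k, hk⟩ := h (Pi.single i 1 + Pi.single j 1)
      obtain ⟨a, ha⟩ := hdiag i
      obtain ⟨b, hb⟩ := hdiag j
      refine ⟨k - a - b, ?_⟩
      push_cast
      rw [← hk, ← ha, ← hb, qf_expand hA]
      have h1 := hA.apply 0 1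
      have h2 := hA.apply 0 2
      have h3 := hA.apply 1 2
      fin_cases i <;> fin_cases j <;> simp_all <;> ring
    intro i j
    by_cases hij : i = j
    · subst hij
      obtain ⟨a, ha⟩ := hdiag i
      exact ⟨2 * a, by rw [ha]; push_cast; ring⟩
    · exact off i j hij

/-- The polar form of the quadratic form with Gram matrix `A`. -/
def polar3 (A : RatMat) (x y : Fin 3 → ℤ) : ℚ := qf A (x + y) - qf A x - qf A y

lemma polar3_mulVec (A : RatMat) (X : IntMat) (x y : Fin 3 → ℤ) :
    polar3 A (X.mulVec x) (X.mulVec y) = polar3 ((intMap X)ᵀ * A * intMap X) x y := by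
  simp only [polar3, ← Matrix.mulVec_add, qf_mulVec]

lemma polar3_smul (A : RatMat) (c : ℚ) (x y : Fin 3 → ℤ) :
    polar3 (c • A) x y = c * polar3 A x y := by
  simp only [polar3, qf_smul]; ring

lemma isSymm_transpose_mul_mul {A : RatMat} (hA : A.IsSymm) (X : RatMat) : (Xᵀ * A * X).IsSymm := by
  unfold Matrix.IsSymm
  rw [Matrix.transpose_mul, Matrix.transpose_mul, Matrix.transpose_transpose, hA.eq,
    Matrix.mul_assoc]

lemma PosDef3.transform {A : RatMat} (hA : PosDef3 A) {X : IntMat} (hX : X.det ≠ 0) {c : ℚ}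
    (hc : 0 < c) : PosDef3 (c • ((intMap X)ᵀ * A * intMap X)) := by
  refine ⟨(isSymm_transpose_mul_mul hA.1 _).smul c, fun x hx => ?_⟩
  have h : (intMap X).mulVec x ≠ 0 := by
    intro h0
    have := Matrix.exists_mulVec_eq_zero_iff.1 ⟨x, hx, h0⟩
    rw [intMap_det] at this
    exact hX (by exact_mod_cast this)
  have := hA.2 _ h
  rw [Matrix.smul_mulVec, dotProduct_smul, ← Matrix.mulVec_mulVec, ← Matrix.mulVec_mulVec,
    Matrix.dotProduct_mulVec _ (intMap X)ᵀ, Matrix.vecMul_transpose]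
  exact mul_pos hc this

lemma PosDef3.det_ne_zero {A : RatMat} (hA : PosDef3 A) : A.det ≠ 0 := by
  intro h
  obtain ⟨v, hv, h0⟩ := Matrix.exists_mulVec_eq_zero_iff.2 h
  have := hA.2 v hv
  rw [h0, dotProduct_zero] at this
  exact lt_irrefl _ this

lemma PosDef3.cauchy_schwarz {A : RatMat} (hA : PosDef3 A) (v x : Fin 3 → ℚ) :
    (v ⬝ᵥ A.mulVec x) ^ 2 ≤ (v ⬝ᵥ A.mulVec v) * (x ⬝ᵥ A.mulVec x) := by
  by_cases hv : v = 0
  · simp [hv]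
  have hp := hA.2 v hv
  have hs : x ⬝ᵥ A.mulVec v = v ⬝ᵥ A.mulVec x := by
    rw [Matrix.dotProduct_mulVec, ← Matrix.mulVec_transpose, hA.1.eq, dotProduct_comm]
  set q := v ⬝ᵥ A.mulVec v
  set b := v ⬝ᵥ A.mulVec x
  have hnn : 0 ≤ (q • x - b • v) ⬝ᵥ A.mulVec (q • x - b • v) := by
    by_cases h0 : q • x - b • v = 0
    · simp [h0]
    · exact (hA.2 _ h0).le
  have : (q • x - b • v) ⬝ᵥ A.mulVec (q • x - b • v) = q * (q * (x ⬝ᵥ A.mulVec x) - b ^ 2) := by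
    simp only [Matrix.mulVec_sub, Matrix.mulVec_smul, dotProduct_sub, sub_dotProduct,
      dotProduct_smul, smul_dotProduct, smul_eq_mul, hs]
    ring
  rw [this] at hnn
  have := nonneg_of_mul_nonneg_right hnn hp
  linarith

lemma PosDef3.finite_level {A : RatMat} (hA : PosDef3 A) (N : ℚ) :
    {x : Fin 3 → ℤ | qf A x = N}.Finite := by
  have hu : IsUnit A.det := isUnit_iff_ne_zero.2 hA.det_ne_zero
  have key : ∀ i, ∃ B : ℤ, ∀ x : Fin 3 → ℤ, qf A x = N → x i ∈ Set.Icc (-B) B := by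
    intro i
    set v := A⁻¹.mulVec (Pi.single i 1)
    obtain ⟨B, hB⟩ := exists_nat_ge ((v ⬝ᵥ A.mulVec v) * N)
    refine ⟨B, fun x hx => ?_⟩
    have h := hA.cauchy_schwarz v (fun i => (x i : ℚ))
    have h1 : v ⬝ᵥ A.mulVec (fun i => (x i : ℚ)) = x i := by
      rw [Matrix.dotProduct_mulVec, ← Matrix.mulVec_transpose, hA.1.eq, Matrix.mulVec_mulVec,
        Matrix.mul_nonsing_inv _ hu, Matrix.one_mulVec, single_dotProduct, one_mul]
    rw [h1] at h
    have h2 : ((x i : ℚ)) ^ 2 ≤ B := h.trans (by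
      have : (fun i => (x i : ℚ)) ⬝ᵥ A.mulVec (fun i => (x i : ℚ)) = N := hx
      rw [this]; exact hB)
    have h3 : (x i) ^ 2 ≤ (B : ℤ) := by exact_mod_cast h2
    exact ⟨by nlinarith, by nlinarith⟩
  choose B hB using key
  refine (Set.Finite.pi' (fun i => Set.finite_Icc (-B i) (B i))).subset fun x hx i => hB i x hx

lemma PosDef3.finite_isometries {A : RatMat} (hA : PosDef3 A) (B : RatMat) :
    {X : IntMat | (intMap X)ᵀ * A * intMap X = B}.Finite := by
  have h := Set.Finite.pi' (fun j : Fin 3 => hA.finite_level (B j j))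
  refine Set.Finite.of_finite_image (f := Matrix.transpose) (h.subset ?_)
    (Matrix.transpose_injective.injOn)
  rintro _ ⟨X, hX, rfl⟩ j
  have hX' : (intMap X)ᵀ * A * intMap X = B := hX
  have h1 : Xᵀ j = X.mulVec (Pi.single j 1) := by
    rw [Matrix.mulVec_single_one]; rfl
  change qf A (Xᵀ j) = B j j
  rw [h1, qf_mulVec, hX']
  have h2 : (fun i => (((Pi.single j 1 : Fin 3 → ℤ) i : ℤ) : ℚ)) = Pi.single j 1 := by
    ext i
    by_cases hij : i = j
    · subst hij; simp
    · simp [hij]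
  rw [qf, h2, Matrix.mulVec_single_one, single_dotProduct]
  simp

lemma PosDef3.autNum_pos {A : RatMat} (hA : PosDef3 A) : 0 < autNum A := by
  have : Finite {X : IntMat // IsUnit X.det ∧ (intMap X)ᵀ * A * intMap X = A} :=
    ((hA.finite_isometries A).subset fun X hX => hX.2).to_subtype
  have : Nonempty {X : IntMat // IsUnit X.det ∧ (intMap X)ᵀ * A * intMap X = A} :=
    ⟨⟨1, by simp, by simp [intMap_one]⟩⟩
  exact Nat.card_pos

lemma intMap_transform_mul (A : RatMat) (X Y : IntMat) :
    (intMap (X * Y))ᵀ * A * intMap (X * Y) =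
      (intMap Y)ᵀ * ((intMap X)ᵀ * A * intMap X) * intMap Y := by
  rw [intMap_mul, Matrix.transpose_mul]
  simp only [Matrix.mul_assoc]

lemma det_transform (A : RatMat) (X : IntMat) :
    ((intMap X)ᵀ * A * intMap X).det = (X.det : ℚ) ^ 2 * A.det := by
  rw [Matrix.det_mul, Matrix.det_mul, Matrix.det_transpose, intMap_det]
  ring

/-- A hyperbolic pair in a nondegenerate ternary space is completed by a cross product to a basis
with Gram matrix `H ⊕ [-4 det A]`. -/
lemma hyperbolic_completion {K : Type*} [Field K] (h2 : (2 : K) ≠ 0)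
    {A : Matrix (Fin 3) (Fin 3) K} (hA : A.IsSymm) {e f : Fin 3 → K}
    (he : e ⬝ᵥ A.mulVec e = 0) (hf : f ⬝ᵥ A.mulVec f = 0) (hef : e ⬝ᵥ A.mulVec f = 1 / 2)
    {W : Matrix (Fin 3) (Fin 3) K}
    (hW : W = Matrix.of ![e, f, ((2 : K) • A.mulVec e) ⨯₃ ((2 : K) • A.mulVec f)]) :
    W * A * Wᵀ = !![0, 1/2, 0; 1/2, 0, 0; 0, 0, -4 * A.det] ∧ W.det = -1 := by
  set c := ((2 : K) • A.mulVec e) ⨯₃ ((2 : K) • A.mulVec f) with hc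
  have hs : ∀ x y, x ⬝ᵥ A.mulVec y = y ⬝ᵥ A.mulVec x := fun x y => by
    rw [Matrix.dotProduct_mulVec, ← Matrix.mulVec_transpose, hA.eq, dotProduct_comm]
  have hce : c ⬝ᵥ A.mulVec e = 0 := by
    have := dot_self_cross ((2 : K) • A.mulVec e) ((2 : K) • A.mulVec f)
    rw [smul_dotProduct, ← hc, smul_eq_mul, dotProduct_comm] at this
    exact (mul_eq_zero.1 this).resolve_left h2
  have hcf : c ⬝ᵥ A.mulVec f = 0 := by
    have := dot_cross_self ((2 : K) • A.mulVec e) ((2 : K) • A.mulVec f)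
    rw [smul_dotProduct, ← hc, smul_eq_mul, dotProduct_comm] at this
    exact (mul_eq_zero.1 this).resolve_left h2
  have hdet : W.det = -1 := by
    have h1 : W.det = e ⬝ᵥ f ⨯₃ c := by rw [triple_product_eq_det, hW]; rfl
    rw [h1, triple_product_permutation, triple_product_permutation, hc, dotProduct_comm,
      cross_dot_cross]
    simp only [dotProduct_smul, smul_eq_mul, he, hf, hef, hs f e]
    field_simp
    norm_num
  have hent : ∀ i j, (W * A * Wᵀ) i j = W i ⬝ᵥ A.mulVec (W j) := by
    intro i j
    simp only [Matrix.mul_apply, Matrix.transpose_apply, dotProduct, Matrix.mulVec,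
      Fin.sum_univ_three]
    ring
  have hgram : W * A * Wᵀ = !![0, 1/2, 0; 1/2, 0, 0; 0, 0, c ⬝ᵥ A.mulVec c] := by
    ext i j
    have r0 : W 0 = e := by rw [hW]; rfl
    have r1 : W 1 = f := by rw [hW]; rfl
    have r2 : W 2 = c := by rw [hW]; rfl
    rw [hent]
    fin_cases i <;> fin_cases j <;>
      simp [r0, r1, r2, he, hf, hef, hce, hcf, hs f e, hs e c, hs f c]
  refine ⟨?_, hdet⟩
  have hd := congrArg Matrix.det hgram
  rw [Matrix.det_mul, Matrix.det_mul, Matrix.det_transpose, hdet, Matrix.det_fin_three !![_, _, _; _, _, _; _, _, _]] at hd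
  simp at hd
  rw [hgram]
  have : c ⬝ᵥ A.mulVec c = -4 * A.det := by
    rw [hd]
    field_simp
    ring
  rw [this]

lemma exists_isUnit_root_near_zero {p : ℕ} [Fact p.Prime] (a b : ℤ_[p]) {l : ℤ_[p]}
    (hl : IsUnit l) : ∃ z : ℤ_[p], p * b + l * z + a * z ^ 2 = 0 ∧ (p : ℤ_[p]) ∣ z := by
  set F : Polynomial ℤ_[p] := Polynomial.C (p * b) + Polynomial.C l * Polynomial.X +
    Polynomial.C a * Polynomial.X ^ 2 with hF
  have h0 : F.aeval (0 : ℤ_[p]) = p * b := by simp [hF]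
  have h1 : F.derivative.aeval (0 : ℤ_[p]) = l := by simp [hF]
  have hlt : ‖(p : ℤ_[p]) * b‖ < 1 := (PadicInt.norm_lt_one_iff_dvd _).2 (dvd_mul_right _ _)
  obtain ⟨z, hz, hz1, -⟩ := hensels_lemma (F := F) (a := (0 : ℤ_[p]))
    (by rw [h0, h1, PadicInt.isUnit_iff.1 hl]; simpa using hlt)
  refine ⟨z, by simpa [hF] using hz, ?_⟩
  rw [h1, PadicInt.isUnit_iff.1 hl, sub_zero] at hz1
  exact (PadicInt.norm_lt_one_iff_dvd _).1 hz1

lemma isUnit_intCast_padicInt {p : ℕ} [Fact p.Prime] {l : ℤ} (hl : ¬ (p : ℤ) ∣ l) :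
    IsUnit (l : ℤ_[p]) := by
  rw [PadicInt.isUnit_iff]
  refine le_antisymm (PadicInt.norm_le_one _) (not_lt.1 fun h => hl ?_)
  exact (PadicInt.norm_int_lt_one_iff_dvd l).1 h

lemma cast_dotProduct_mulVec {K : Type*} [Field K] [CharZero K] (A : RatMat) (x y : Fin 3 → ℤ) :
    (((fun i => (x i : ℚ)) ⬝ᵥ A.mulVec fun i => (y i : ℚ) : ℚ) : K) =
      (fun i => (x i : K)) ⬝ᵥ (A.map fun a => (a : K)).mulVec fun i => (y i : K) := by
  simp [dotProduct, Matrix.mulVec]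

lemma map_det_ratCast {K : Type*} [Field K] [CharZero K] (A : RatMat) :
    (A.map fun a => (a : K)).det = (A.det : K) :=
  (RingHom.map_det (Rat.castHom K) A).symm

lemma polar3_eq {A : RatMat} (hA : A.IsSymm) (x y : Fin 3 → ℤ) :
    polar3 A x y = 2 * ((fun i => (x i : ℚ)) ⬝ᵥ A.mulVec fun i => (y i : ℚ)) := by
  have hs : (fun i => (y i : ℚ)) ⬝ᵥ A.mulVec (fun i => (x i : ℚ)) =
      (fun i => (x i : ℚ)) ⬝ᵥ A.mulVec fun i => (y i : ℚ) := by
    rw [Matrix.dotProduct_mulVec, ← Matrix.mulVec_transpose, hA.eq, dotProduct_comm]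
  have hc : (fun i => (((x + y) i : ℤ) : ℚ)) = (fun i => (x i : ℚ)) + fun i => (y i : ℚ) := by
    ext i; simp
  simp only [polar3, qf, hc, Matrix.mulVec_add, dotProduct_add, add_dotProduct, hs]
  ring

/-- A half-integral form of determinant `-η δ² / 4` which has, modulo `p`, an isotropic vector
outside the radical is `ℤ_p`-equivalent to `H ⊕ [η]`. -/
lemma zpEquivTo_of_isotropic_mod {p : ℕ} [Fact p.Prime] {A : RatMat} (hA : A.IsSymm)
    (hh : HalfIntegral A) {δ : ℤ_[p]ˣ} {η : ℤ_[p]}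
    (hdet : 4 * (A.det : ℚ_[p]) = -((η * (δ : ℤ_[p]) ^ 2 : ℤ_[p]) : ℚ_[p])) {b a : Fin 3 → ℤ} {k l : ℤ}
    (hb : qf A b = p * k) (hab : polar3 A b a = l) (hl : ¬ (p : ℤ) ∣ l) :
    ZpEquivTo p A (Hblock p (η : ℚ_[p])) := by
  obtain ⟨n, hn⟩ := (halfIntegral_iff hA).1 hh a
  obtain ⟨z, hz, hpz⟩ := exists_isUnit_root_near_zero (n : ℤ_[p]) (k : ℤ_[p])
    (isUnit_intCast_padicInt hl)
  have hlam : IsUnit ((l : ℤ_[p]) + 2 * z * n) := by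
    rw [PadicInt.isUnit_iff]
    refine le_antisymm (PadicInt.norm_le_one _) (not_lt.1 fun h => ?_)
    have h1 := (PadicInt.norm_lt_one_iff_dvd _).1 h
    have h2 : (p : ℤ_[p]) ∣ l := by
      have := dvd_sub h1 ((hpz.mul_left 2).mul_right (n : ℤ_[p]))
      rwa [add_sub_cancel_right] at this
    have h3 := (PadicInt.norm_lt_one_iff_dvd _).2 h2
    exact hl ((PadicInt.norm_int_lt_one_iff_dvd l).1 h3)
  obtain ⟨lam, hlam'⟩ := hlam
  choose m hm using hh.2
  set A' := A.map fun a => (a : ℚ_[p]) with hA'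
  have hA's : A'.IsSymm := by
    ext i j
    simp [hA', hA.apply i j]
  have hs : ∀ x y, x ⬝ᵥ A'.mulVec y = y ⬝ᵥ A'.mulVec x := fun x y => by
    rw [Matrix.dotProduct_mulVec, ← Matrix.mulVec_transpose, hA's.eq, dotProduct_comm]
  have hm' : ∀ i j, 2 * A' i j = ((m i j : ℤ_[p]) : ℚ_[p]) := by
    intro i j
    simp only [hA', Matrix.map_apply]
    have := congrArg (fun q : ℚ => (q : ℚ_[p])) (hm i j)
    push_cast at this
    simpa using this
  let e0 : Fin 3 → ℤ_[p] := fun i => b i + z * a i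
  let f0 : Fin 3 → ℤ_[p] := fun i =>
    ((lam⁻¹ : ℤ_[p]ˣ) : ℤ_[p]) * a i - ((lam⁻¹ : ℤ_[p]ˣ) : ℤ_[p]) ^ 2 * n * e0 i
  let M : Matrix (Fin 3) (Fin 3) ℤ_[p] := Matrix.of fun i j => (m i j : ℤ_[p])
  let W0 : Matrix (Fin 3) (Fin 3) ℤ_[p] := Matrix.of ![e0, f0, (M.mulVec e0) ⨯₃ (M.mulVec f0)]
  set b' : Fin 3 → ℚ_[p] := fun i => (b i : ℚ_[p]) with hb'
  set a' : Fin 3 → ℚ_[p] := fun i => (a i : ℚ_[p]) with ha'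
  set e : Fin 3 → ℚ_[p] := fun i => (e0 i : ℚ_[p]) with he
  set f : Fin 3 → ℚ_[p] := fun i => (f0 i : ℚ_[p]) with hf
  set v : ℚ_[p] := (((lam⁻¹ : ℤ_[p]ˣ) : ℤ_[p]) : ℚ_[p]) with hv
  have hvl : v * ((l : ℚ_[p]) + 2 * z * n) = 1 := by
    have : ((lam⁻¹ : ℤ_[p]ˣ) : ℤ_[p]) * ((l : ℤ_[p]) + 2 * z * n) = 1 := by
      rw [← hlam']; exact lam.inv_mul
    have := congrArg (fun q : ℤ_[p] => (q : ℚ_[p])) this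
    push_cast at this
    exact this
  have hz' : (p : ℚ_[p]) * k + l * z + n * (z : ℚ_[p]) ^ 2 = 0 := by
    have := congrArg (fun q : ℤ_[p] => (q : ℚ_[p])) hz
    push_cast at this
    exact this
  have hee : e = b' + (z : ℚ_[p]) • a' := by
    ext i; simp [he, e0, hb', ha']
  have hff : f = v • a' - (v ^ 2 * n) • e := by
    ext i; simp [hf, f0, ha', he, hv]
  have hbb : b' ⬝ᵥ A'.mulVec b' = p * k := by
    rw [hb', hA', ← cast_dotProduct_mulVec]
    have := congrArg (fun q : ℚ => (q : ℚ_[p])) hb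
    push_cast at this
    exact this
  have haa : a' ⬝ᵥ A'.mulVec a' = n := by
    rw [ha', hA', ← cast_dotProduct_mulVec]
    have := congrArg (fun q : ℚ => (q : ℚ_[p])) hn
    push_cast at this
    exact this
  have hba : 2 * (b' ⬝ᵥ A'.mulVec a') = l := by
    rw [hb', ha', hA', ← cast_dotProduct_mulVec]
    rw [polar3_eq hA] at hab
    have := congrArg (fun q : ℚ => (q : ℚ_[p])) hab
    push_cast at this
    simpa using this
  have hea : 2 * (e ⬝ᵥ A'.mulVec a') = l + 2 * z * n := by
    rw [hee, add_dotProduct, smul_dotProduct, haa, mul_add, hba, smul_eq_mul]; ring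
  have he0 : e ⬝ᵥ A'.mulVec e = 0 := by
    rw [hee]
    simp only [Matrix.mulVec_add, Matrix.mulVec_smul, dotProduct_add, add_dotProduct,
      smul_dotProduct, dotProduct_smul, hbb, haa, hs a' b', smul_eq_mul]
    linear_combination hz' + (z : ℚ_[p]) * hba
  have hef : e ⬝ᵥ A'.mulVec f = 1 / 2 := by
    rw [hff, Matrix.mulVec_sub, Matrix.mulVec_smul, Matrix.mulVec_smul, dotProduct_sub,
      dotProduct_smul, dotProduct_smul, he0, smul_eq_mul, smul_zero, sub_zero]
    linear_combination v / 2 * hea + hvl / 2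
  have hf0 : f ⬝ᵥ A'.mulVec f = 0 := by
    rw [hff]
    simp only [Matrix.mulVec_sub, Matrix.mulVec_smul, dotProduct_sub, sub_dotProduct,
      smul_dotProduct, dotProduct_smul, he0, haa, hs a' e, smul_eq_mul]
    linear_combination (-v ^ 3 * n) * hea - v ^ 2 * n * hvl
  have h2 : (2 : ℚ_[p]) ≠ 0 := two_ne_zero
  have hMe : ∀ x : Fin 3 → ℤ_[p], (2 : ℚ_[p]) • A'.mulVec (fun i => (x i : ℚ_[p])) =
      fun i => ((M.mulVec x i : ℤ_[p]) : ℚ_[p]) := by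
    intro x
    ext i
    simp only [Pi.smul_apply, smul_eq_mul, Matrix.mulVec, dotProduct, Fin.sum_univ_three, M,
      Matrix.of_apply, PadicInt.coe_add, PadicInt.coe_mul, ← hm']
    ring
  obtain ⟨hG, hD⟩ := hyperbolic_completion h2 hA's he0 hf0 hef
    (W := W0.map fun a => (a : ℚ_[p])) (by
      rw [he, hf, hMe, hMe]
      ext i j
      fin_cases i
      · rfl
      · rfl
      · fin_cases j <;> simp [W0, cross_apply])
  have hWdet : W0.det = -1 := by
    have h1 := RingHom.map_det PadicInt.Coe.ringHom W0
    apply Subtype.coe_injective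
    have h3 : ((W0.det : ℤ_[p]) : ℚ_[p]) = -1 := h1.trans hD
    change ((W0.det : ℤ_[p]) : ℚ_[p]) = ((-1 : ℤ_[p]) : ℚ_[p])
    rw [h3]
    simp
  let Dg : Matrix (Fin 3) (Fin 3) ℤ_[p] := Matrix.diagonal ![1, 1, ((δ⁻¹ : ℤ_[p]ˣ) : ℤ_[p])]
  have hX : (W0ᵀ * Dg).map (fun a => (a : ℚ_[p])) =
      (W0.map fun a => (a : ℚ_[p]))ᵀ * Dg.map fun a => (a : ℚ_[p]) :=
    Matrix.map_mul (f := PadicInt.Coe.ringHom)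
  refine ⟨W0ᵀ * Dg, ?_, ?_⟩
  · rw [Matrix.det_mul, Matrix.det_transpose, hWdet, Matrix.det_diagonal]
    simp [Fin.prod_univ_three]
  · rw [hX, Matrix.transpose_mul, Matrix.transpose_transpose]
    have : (Dg.map fun a => (a : ℚ_[p]))ᵀ * W0.map (fun a => (a : ℚ_[p])) * A' *
        ((W0.map fun a => (a : ℚ_[p]))ᵀ * Dg.map fun a => (a : ℚ_[p])) =
        (Dg.map fun a => (a : ℚ_[p]))ᵀ * (W0.map (fun a => (a : ℚ_[p])) * A' *
        (W0.map fun a => (a : ℚ_[p]))ᵀ) * Dg.map fun a => (a : ℚ_[p]) := by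
      simp only [Matrix.mul_assoc]
    rw [this, hG, hA', map_det_ratCast]
    have hDg : Dg.map (fun a => (a : ℚ_[p])) =
        Matrix.diagonal ![1, 1, (((δ⁻¹ : ℤ_[p]ˣ) : ℤ_[p]) : ℚ_[p])] := by
      ext i j
      fin_cases i <;> fin_cases j <;> simp [Dg]
    have hdd : (((δ⁻¹ : ℤ_[p]ˣ) : ℤ_[p]) : ℚ_[p]) * ((δ : ℤ_[p]) : ℚ_[p]) = 1 := by
      rw [← PadicInt.coe_mul, Units.inv_mul, PadicInt.coe_one]
    rw [hDg, Matrix.diagonal_transpose, Hblock]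
    rw [PadicInt.coe_mul, PadicInt.coe_pow] at hdet
    ext i j
    rw [Matrix.mul_diagonal, Matrix.diagonal_mul]
    fin_cases i <;> fin_cases j <;> simp
    generalize ((((δ⁻¹ : ℤ_[p]ˣ) : ℤ_[p]) : ℚ_[p])) = d' at hdd ⊢
    linear_combination (-(d' ^ 2)) * hdet + (η : ℚ_[p]) * (d' * (δ : ℤ_[p]) + 1) * hdd

/-- Coordinates over `ℤ_p` in which the form with Gram matrix `A` becomes
`u₀ u₁ + η u₂²`. -/
structure LocalCoord (p : ℕ) [Fact p.Prime] (A : RatMat) (η : ℤ_[p]) where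
  u : (Fin 3 → ℤ) →+ (Fin 3 → ℤ_[p])
  qf_eq : ∀ x, ((qf A x : ℚ) : ℚ_[p]) = ((u x 0 * u x 1 + η * u x 2 ^ 2 : ℤ_[p]) : ℚ_[p])
  prim : ∀ x, (∀ i, (p : ℤ_[p]) ∣ u x i) → ∃ y : Fin 3 → ℤ, x = (p : ℤ) • y

lemma natCast_dvd_intCast_padicInt {p : ℕ} [Fact p.Prime] {k : ℤ} :
    (p : ℤ_[p]) ∣ k ↔ (p : ℤ) ∣ k := by
  rw [← PadicInt.norm_lt_one_iff_dvd, PadicInt.norm_int_lt_one_iff_dvd]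

lemma exists_localCoord_of_zpEquivTo {p : ℕ} [Fact p.Prime] {A : RatMat} {η : ℤ_[p]}
    (h : ZpEquivTo p A (Hblock p (η : ℚ_[p]))) : Nonempty (LocalCoord p A η) := by
  obtain ⟨X, hX, hXA⟩ := h
  set X' := X.map fun a => (a : ℚ_[p]) with hX'
  set A' := A.map fun a => (a : ℚ_[p]) with hA'
  let u : (Fin 3 → ℤ) →+ (Fin 3 → ℤ_[p]) :=
    { toFun := fun x => X⁻¹.mulVec fun i => (x i : ℤ_[p])
      map_zero' := by
        have : (fun i => (((0 : Fin 3 → ℤ) i : ℤ) : ℤ_[p])) = 0 := by ext i; simp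
        rw [this, Matrix.mulVec_zero]
      map_add' := fun x y => by
        rw [← Matrix.mulVec_add]
        congr 1
        ext i
        simp }
  have hu : ∀ x, X.mulVec (u x) = fun i => (x i : ℤ_[p]) := fun x => by
    change X.mulVec (X⁻¹.mulVec _) = _
    rw [Matrix.mulVec_mulVec, Matrix.mul_nonsing_inv _ hX, Matrix.one_mulVec]
  refine ⟨⟨u, fun x => ?_, fun x hx => ?_⟩⟩
  · have h1 : (fun i => (x i : ℚ_[p])) = X'.mulVec fun i => (u x i : ℚ_[p]) := by
      ext i
      have := congrArg (fun a : ℤ_[p] => (a : ℚ_[p])) (congrFun (hu x) i)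
      simp only [Matrix.mulVec, dotProduct, Fin.sum_univ_three, PadicInt.coe_add,
        PadicInt.coe_mul, PadicInt.coe_intCast] at this
      simp only [hX', Matrix.mulVec, dotProduct, Fin.sum_univ_three, Matrix.map_apply, this]
    rw [qf, cast_dotProduct_mulVec, h1, Matrix.mulVec_mulVec, Matrix.dotProduct_mulVec,
      ← Matrix.vecMul_transpose, Matrix.vecMul_vecMul, ← Matrix.mul_assoc, hXA,
      ← Matrix.dotProduct_mulVec]
    simp [Hblock, Matrix.mulVec, dotProduct, Fin.sum_univ_three]
    ring
  · have : ∀ i, (p : ℤ) ∣ x i := fun i => by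
      rw [← natCast_dvd_intCast_padicInt (p := p), ← congrFun (hu x) i]
      change _ ∣ ∑ j, X i j * u x j
      exact Finset.dvd_sum fun j _ => (hx j).mul_left _
    choose y hy using this
    exact ⟨y, by ext i; simp [hy i]⟩

namespace LocalCoord

variable {p : ℕ} [Fact p.Prime] {A : RatMat} {η : ℤ_[p]} (L : LocalCoord p A η)

lemma qf_int {x : Fin 3 → ℤ} {k : ℤ} (h : qf A x = k) :
    (k : ℤ_[p]) = L.u x 0 * L.u x 1 + η * L.u x 2 ^ 2 := by
  have := L.qf_eq x
  rw [h, Rat.cast_intCast, ← PadicInt.coe_intCast] at this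
  exact PadicInt.ext this

lemma polar_int {x y : Fin 3 → ℤ} {k : ℤ} (h : polar3 A x y = k) :
    (k : ℤ_[p]) = L.u x 0 * L.u y 1 + L.u y 0 * L.u x 1 + 2 * η * L.u x 2 * L.u y 2 := by
  have h1 := congrArg (fun a : ℚ => (a : ℚ_[p])) h
  simp only [polar3, Rat.cast_sub, L.qf_eq, map_add, Rat.cast_intCast] at h1
  rw [← PadicInt.coe_intCast, ← PadicInt.coe_sub, ← PadicInt.coe_sub] at h1
  rw [← PadicInt.ext h1]
  simp only [Pi.add_apply]
  ring

/-- Reduction of the local coordinates modulo `p`. -/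
def red : (Fin 3 → ℤ) →+ (Fin 3 → ZMod p) :=
  { toFun := fun x i => PadicInt.toZMod (L.u x i)
    map_zero' := by ext i; simp
    map_add' := fun x y => by ext i; simp }

lemma red_apply (x : Fin 3 → ℤ) (i : Fin 3) : L.red x i = PadicInt.toZMod (L.u x i) := rfl

end LocalCoord

lemma toZMod_eq_zero_iff {p : ℕ} [Fact p.Prime] {a : ℤ_[p]} :
    PadicInt.toZMod a = 0 ↔ (p : ℤ_[p]) ∣ a := by
  rw [← RingHom.mem_ker, PadicInt.ker_toZMod, PadicInt.maximalIdeal_eq_span_p,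
    Ideal.mem_span_singleton]

namespace LocalCoord

variable {p : ℕ} [Fact p.Prime] {A : RatMat} {η : ℤ_[p]} (L : LocalCoord p A η)

lemma red_apply_eq_zero {x : Fin 3 → ℤ} {i : Fin 3} : L.red x i = 0 ↔ (p : ℤ_[p]) ∣ L.u x i := by
  rw [red_apply, toZMod_eq_zero_iff]

lemma red_zsmul (k : ℤ) (x : Fin 3 → ℤ) : L.red (k • x) = (k : ZMod p) • L.red x := by
  rw [map_zsmul]
  ext i
  simp

lemma u_zsmul (k : ℤ) (x : Fin 3 → ℤ) (i : Fin 3) : L.u (k • x) i = (k : ℤ_[p]) * L.u x i := by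
  rw [map_zsmul]
  simp

lemma red_eq_zero {x : Fin 3 → ℤ} : L.red x = 0 ↔ ∃ y : Fin 3 → ℤ, x = (p : ℤ) • y := by
  constructor
  · intro h
    exact L.prim x fun i => L.red_apply_eq_zero.1 (congrFun h i)
  · rintro ⟨y, rfl⟩
    rw [red_zsmul]
    simp

lemma red_surjective : Function.Surjective L.red := by
  have hp : (p : ℤ) ≠ 0 := by exact_mod_cast (Fact.out : p.Prime).ne_zero
  have hdet : ((p : ℤ) • (1 : IntMat)).det = (p : ℤ) ^ 3 := by
    rw [Matrix.det_smul]; simp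
  have hk : L.red.ker = colLattice ((p : ℤ) • (1 : IntMat)) := by
    ext x
    rw [AddMonoidHom.mem_ker, L.red_eq_zero, mem_colLattice]
    simp only [Matrix.smul_mulVec, Matrix.one_mulVec]
  have h1 := AddSubgroup.index_ker L.red
  rw [hk, colLattice_index (by rw [hdet]; exact pow_ne_zero _ hp), hdet, Int.natAbs_pow,
    Int.natAbs_natCast] at h1
  have h2 : L.red.range = ⊤ := by
    apply AddSubgroup.eq_top_of_card_eq
    refine h1.symm.trans ?_
    simp
  exact AddMonoidHom.range_eq_top.1 h2

lemma qf_mod {x : Fin 3 → ℤ} {k : ℤ} (h : qf A x = k) :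
    (k : ZMod p) = L.red x 0 * L.red x 1 + PadicInt.toZMod η * L.red x 2 ^ 2 := by
  have := congrArg PadicInt.toZMod (L.qf_int h)
  simpa [red_apply] using this

lemma polar_mod {x y : Fin 3 → ℤ} {k : ℤ} (h : polar3 A x y = k) :
    (k : ZMod p) = L.red x 0 * L.red y 1 + L.red y 0 * L.red x 1 +
      2 * PadicInt.toZMod η * L.red x 2 * L.red y 2 := by
  have := congrArg PadicInt.toZMod (L.polar_int h)
  simpa [red_apply, map_ofNat] using this

/-- The lattice of vectors whose reduction lies in a given subspace. -/
def pre (W : Submodule (ZMod p) (Fin 3 → ZMod p)) : AddSubgroup (Fin 3 → ℤ) :=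
  W.toAddSubgroup.comap L.red

lemma mem_pre {W : Submodule (ZMod p) (Fin 3 → ZMod p)} {x : Fin 3 → ℤ} :
    x ∈ L.pre W ↔ L.red x ∈ W := Iff.rfl

lemma pre_index (W : Submodule (ZMod p) (Fin 3 → ZMod p)) :
    p ^ Module.finrank (ZMod p) W * (L.pre W).index = p ^ 3 := by
  rw [pre, AddSubgroup.index_comap_of_surjective _ L.red_surjective]
  have := AddSubgroup.card_mul_index W.toAddSubgroup
  have h2 : Nat.card W.toAddSubgroup = p ^ Module.finrank (ZMod p) W := by
    have := Module.natCard_eq_pow_finrank (K := ZMod p) (V := W)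
    rw [Nat.card_zmod] at this
    exact this
  rw [← h2, this]
  simp

lemma pre_injective : Function.Injective L.pre := fun W W' h => by
  ext v
  obtain ⟨x, rfl⟩ := L.red_surjective v
  rw [← L.mem_pre, h, L.mem_pre]

end LocalCoord

lemma intCast_zmod_eq_zero_iff {p : ℕ} {k : ℤ} : (k : ZMod p) = 0 ↔ (p : ℤ) ∣ k :=
  ZMod.intCast_zmod_eq_zero_iff_dvd k p

lemma den_eq_one_of_padicNorm_le {x : ℚ}
    (h : ∀ q : ℕ, ∀ hq : q.Prime, haveI : Fact q.Prime := ⟨hq⟩; ‖(x : ℚ_[q])‖ ≤ 1) : x.den = 1 := by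
  by_contra hne
  obtain ⟨q, hq, hqd⟩ := Nat.exists_prime_and_dvd hne
  have : Fact q.Prime := ⟨hq⟩
  have h1 := PadicInt.isUnit_den x (h q hq)
  rw [PadicInt.isUnit_iff, ← Int.cast_natCast] at h1
  have h2 := (PadicInt.norm_int_lt_one_iff_dvd (p := q) (x.den : ℤ)).2 (by exact_mod_cast hqd)
  exact h2.ne h1

/-- Rational numbers with the same `q`-adic norms for all primes `q` agree up to sign. -/
lemma abs_eq_of_padicNorm_eq {x y : ℚ} (hx : x ≠ 0) (hy : y ≠ 0)
    (h : ∀ q : ℕ, ∀ hq : q.Prime, haveI : Fact q.Prime := ⟨hq⟩; ‖(x : ℚ_[q])‖ = ‖(y : ℚ_[q])‖) :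
    |x| = |y| := by
  have key : ∀ a b : ℚ, b ≠ 0 → (∀ q : ℕ, ∀ hq : q.Prime, haveI : Fact q.Prime := ⟨hq⟩;
      ‖(a : ℚ_[q])‖ = ‖(b : ℚ_[q])‖) → ∃ n : ℤ, a = n * b := by
    intro a b hb hab
    have hd : (a / b).den = 1 := den_eq_one_of_padicNorm_le fun q hq => by
      have : Fact q.Prime := ⟨hq⟩
      have hb' : (b : ℚ_[q]) ≠ 0 := by exact_mod_cast hb
      rw [Rat.cast_div, norm_div, hab q hq, div_self (norm_ne_zero_iff.2 hb')]
    refine ⟨(a / b).num, ?_⟩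
    rw [Rat.coe_int_num_of_den_eq_one hd]
    field_simp
  obtain ⟨m, hm⟩ := key x y hy h
  obtain ⟨n, hn⟩ := key y x hx fun q hq => (h q hq).symm
  have h1 : (m : ℚ) * n = 1 := by
    have : ((m : ℚ) * n) * x = 1 * x := by rw [one_mul, mul_assoc, ← hn, ← hm]
    exact mul_right_cancel₀ hx this
  have h2 : |m| = 1 := by
    have : m * n = 1 := by exact_mod_cast h1
    exact Int.isUnit_iff_abs_eq.1 (IsUnit.of_mul_eq_one _ this)
  rw [hm, abs_mul, ← Int.cast_abs, h2, Int.cast_one, one_mul]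

lemma det_map_padicInt_coe {q : ℕ} [Fact q.Prime] (X : Matrix (Fin 3) (Fin 3) ℤ_[q]) :
    (X.map fun a => (a : ℚ_[q])).det = (X.det : ℚ_[q]) :=
  (RingHom.map_det PadicInt.Coe.ringHom X).symm

lemma exists_unit_det_of_zpEquivTo {q : ℕ} [Fact q.Prime] {A : RatMat}
    {B : Matrix (Fin 3) (Fin 3) ℚ_[q]} (h : ZpEquivTo q A B) :
    ∃ δ : ℤ_[q]ˣ, (A.det : ℚ_[q]) * ((δ : ℤ_[q]) : ℚ_[q]) ^ 2 = B.det := by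
  obtain ⟨X, hX, hXA⟩ := h
  refine ⟨hX.unit, ?_⟩
  rw [← hXA, Matrix.det_mul, Matrix.det_mul, Matrix.det_transpose, det_map_padicInt_coe,
    map_det_ratCast, IsUnit.unit_spec]
  ring

lemma det_hblock {q : ℕ} [Fact q.Prime] (c : ℚ_[q]) : (Hblock q c).det = -c / 4 := by
  rw [Hblock, Matrix.det_fin_three]
  simp
  ring

lemma norm_padicInt_unit {q : ℕ} [Fact q.Prime] (δ : ℤ_[q]ˣ) :
    ‖((δ : ℤ_[q]) : ℚ_[q])‖ = 1 := by
  rw [← PadicInt.norm_def]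
  exact PadicInt.isUnit_iff.1 δ.isUnit

lemma norm_det_of_zpEquivTo {q : ℕ} [Fact q.Prime] {A : RatMat}
    {B : Matrix (Fin 3) (Fin 3) ℚ_[q]} (h : ZpEquivTo q A B) :
    ‖(A.det : ℚ_[q])‖ = ‖B.det‖ := by
  obtain ⟨δ, hδ⟩ := exists_unit_det_of_zpEquivTo h
  rw [← hδ, norm_mul, norm_pow, norm_padicInt_unit, one_pow, mul_one]

lemma det_eq_of_genus {p : ℕ} [Fact p.Prime] {ε : ℤ_[p]ˣ} {T S : RatMat} (hT : T.det ≠ 0)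
    (hS : S.det ≠ 0)
    (hTp : ZpEquivTo p T (Hblock p ((p : ℚ_[p]) * ((ε : ℤ_[p]) : ℚ_[p]))))
    (hSp : ZpEquivTo p S (Hblock p ((p : ℚ_[p]) ^ 2 * ((ε : ℤ_[p]) : ℚ_[p]))))
    (hloc : ∀ q : ℕ, ∀ hq : q.Prime, q ≠ p → @ZqEquiv q ⟨hq⟩ S ((p : ℚ) • T)) :
    |S.det| = |p * T.det| := by
  have hp : (p : ℚ) ≠ 0 := by exact_mod_cast (Fact.out : p.Prime).ne_zero
  refine abs_eq_of_padicNorm_eq hS (mul_ne_zero hp hT) fun q hq => ?_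
  have : Fact q.Prime := ⟨hq⟩
  by_cases hqp : q = p
  · subst hqp
    rw [norm_det_of_zpEquivTo hSp, Rat.cast_mul, norm_mul, norm_det_of_zpEquivTo hTp, det_hblock,
      det_hblock, ← norm_mul]
    congr 1
    push_cast
    ring
  · have h1 := norm_det_of_zpEquivTo (q := q) (hloc q hq hqp)
    have h2 : ‖(p : ℚ_[q])‖ = 1 := by
      have := PadicInt.isUnit_iff.1 (isUnit_intCast_padicInt (p := q) (l := p)
        (by exact_mod_cast fun h => hqp ((Nat.prime_dvd_prime_iff_eq hq Fact.out).1 h)))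
      rw [PadicInt.norm_def] at this
      simpa using this
    rw [h1, map_det_ratCast, Matrix.det_smul]
    simp [h2]

/-- A sublattice of index `p²` of `T` which is `p`-divisible and has a vector that is isotropic
modulo `p` but not in the radical belongs, after scaling, to the genus `H ⊕ [p² ε]`. -/
lemma genus_of_sublattice {p : ℕ} [Fact p.Prime] {ε : ℤ_[p]ˣ} {T : RatMat} (hT : PosDef3 T)
    (hTp : ZpEquivTo p T (Hblock p ((p : ℚ_[p]) * ((ε : ℤ_[p]) : ℚ_[p]))))
    {W : IntMat} (hW : W.det.natAbs = p ^ 2) {A : RatMat}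
    (hA : A = ((p : ℚ))⁻¹ • ((intMap W)ᵀ * T * intMap W)) (hAh : HalfIntegral A)
    {b a : Fin 3 → ℤ} {k l : ℤ}
    (hb : qf A b = p * k) (hab : polar3 A b a = l) (hl : ¬ (p : ℤ) ∣ l) :
    PosDef3 A ∧ ZpEquivTo p A (Hblock p ((p : ℚ_[p]) ^ 2 * ((ε : ℤ_[p]) : ℚ_[p]))) ∧
      ∀ q : ℕ, ∀ hq : q.Prime, q ≠ p → @ZqEquiv q ⟨hq⟩ A ((p : ℚ) • T) := by
  have hp0 : p ≠ 0 := (Fact.out : p.Prime).ne_zero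
  have hp : (p : ℚ) ≠ 0 := by exact_mod_cast hp0
  have hpp : (p : ℚ_[p]) ≠ 0 := by exact_mod_cast hp0
  have hWd : W.det ≠ 0 := fun h => by
    rw [h] at hW
    exact pow_ne_zero 2 hp0 hW.symm
  have hW2 : (W.det : ℚ) ^ 2 = (p : ℚ) ^ 4 := by
    have : W.det ^ 2 = (p : ℤ) ^ 4 := by
      rw [← Int.natAbs_sq, hW]; push_cast; ring
    exact_mod_cast this
  have hAP : PosDef3 A := hA ▸ hT.transform hWd (by positivity)
  have hdet : A.det = p * T.det := by
    rw [hA, Matrix.det_smul, det_transform, hW2]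
    simp
    field_simp
  refine ⟨hAP, ?_, fun q hq hqp => ?_⟩
  · obtain ⟨δ, hδ⟩ := exists_unit_det_of_zpEquivTo hTp
    rw [det_hblock] at hδ
    have hdd : (((δ⁻¹ : ℤ_[p]ˣ) : ℤ_[p]) : ℚ_[p]) * ((δ : ℤ_[p]) : ℚ_[p]) = 1 := by
      rw [← PadicInt.coe_mul, Units.inv_mul, PadicInt.coe_one]
    have := zpEquivTo_of_isotropic_mod hAP.1 hAh (δ := δ⁻¹) (η := (p : ℤ_[p]) ^ 2 * ε) (by
      rw [hdet, PadicInt.coe_mul, PadicInt.coe_mul, PadicInt.coe_pow, PadicInt.coe_pow,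
        PadicInt.coe_natCast, Rat.cast_mul, Rat.cast_natCast]
      generalize ((((δ⁻¹ : ℤ_[p]ˣ) : ℤ_[p]) : ℚ_[p])) = d' at hdd ⊢
      linear_combination (4 * p * d' ^ 2) * hδ - 4 * p * (T.det : ℚ_[p]) * (d' * (δ : ℤ_[p]) + 1) * hdd) hb hab hl
    simpa using this
  · have : Fact q.Prime := ⟨hq⟩
    have hqd : ¬ (q : ℤ) ∣ W.det := fun h => by
      have h1 : q ∣ p ^ 2 := hW ▸ Int.natCast_dvd.1 h
      exact hqp ((Nat.prime_dvd_prime_iff_eq hq Fact.out).1 (hq.dvd_of_dvd_pow h1))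
    have hqp' : ¬ (q : ℤ) ∣ (p : ℤ) := by
      exact_mod_cast fun h => hqp ((Nat.prime_dvd_prime_iff_eq hq Fact.out).1 h)
    let Wq : Matrix (Fin 3) (Fin 3) ℤ_[q] := W.map fun a => (a : ℤ_[q])
    have hdq : Wq.det = (W.det : ℤ_[q]) := (RingHom.map_det (Int.castRingHom ℤ_[q]) W).symm
    have hWu : IsUnit Wq.det := hdq ▸ isUnit_intCast_padicInt hqd
    have hpu : IsUnit (p : ℤ_[q]) := by
      simpa using isUnit_intCast_padicInt (p := q) (l := p) hqp'
    refine ⟨(p : ℤ_[q]) • Wq⁻¹, ?_, ?_⟩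
    · rw [Matrix.det_smul]
      exact (hpu.pow _).mul ((Matrix.isUnit_nonsing_inv_det_iff).2 hWu)
    · set X : Matrix (Fin 3) (Fin 3) ℚ_[q] :=
        ((p : ℤ_[q]) • Wq⁻¹).map fun a => (a : ℚ_[q]) with hX
      set W' : Matrix (Fin 3) (Fin 3) ℚ_[q] := Wq.map fun a => (a : ℚ_[q]) with hW'
      have hWX : W' * X = (p : ℚ_[q]) • 1 := by
        have h1 : Wq * ((p : ℤ_[q]) • Wq⁻¹) = (p : ℤ_[q]) • 1 := by
          rw [Matrix.mul_smul, Matrix.mul_nonsing_inv _ hWu]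
        have h2 := congrArg (fun M => PadicInt.Coe.ringHom.mapMatrix M) h1
        simp only [map_mul] at h2
        refine h2.trans ?_
        ext i j
        by_cases hij : i = j <;> simp [hij]
      have hA' : A.map (fun a => (a : ℚ_[q])) =
          (p : ℚ_[q])⁻¹ • (W'ᵀ * T.map (fun a => (a : ℚ_[q])) * W') := by
        rw [hA]
        ext i j
        simp [Matrix.mul_apply, hW', Wq, intMap]
      have hpq : (p : ℚ_[q]) ≠ 0 := by exact_mod_cast hp0
      have e1 : Xᵀ * (W'ᵀ * T.map (fun a => (a : ℚ_[q])) * W') * X =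
          (W' * X)ᵀ * T.map (fun a => (a : ℚ_[q])) * (W' * X) := by
        simp only [Matrix.transpose_mul, Matrix.mul_assoc]
      rw [hA', Matrix.mul_smul, Matrix.smul_mul, e1, hWX]
      ext i j
      simp
      field_simp

/-- Counting representations by a complete system of classes through the sublattices
isometric to them. -/
lemma sum_orbits {g : ℕ} {S : Fin g → RatMat} (hS : ∀ i, PosDef3 (S i))
    (hne : ∀ i j, i ≠ j → ¬ ZEquiv (S i) (S j)) {B : RatMat} {c : ℚ} (hc : c ≠ 0)
    {ι : Type*} {E : Finset ι} {M : ι → AddSubgroup (Fin 3 → ℤ)} (hM : Set.InjOn M E)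
    {R : Fin g → Set IntMat}
    (hR : ∀ i X, X ∈ R i ↔ (intMap X)ᵀ * B * intMap X = c • S i ∧ ∃ e ∈ E, colLattice X = M e)
    (hex : ∀ e ∈ E, ∃ i X, (intMap X)ᵀ * B * intMap X = c • S i ∧ colLattice X = M e) (N : ℤ) :
    ∑ i, (Nat.card (R i) : ℚ) / autNum (S i) * rEval (S i) N =
      ∑ e ∈ E, (Nat.card {x // x ∈ M e ∧ qf B x = c * N} : ℚ) := by
  classical
  choose i₀ X₀ hX₀ using fun e : E => hex e e.2
  have hX₀d : ∀ e, (X₀ e).det ≠ 0 := fun e h0 => by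
    have h1 := congrArg Matrix.det (hX₀ e).1
    rw [det_transform, h0, Matrix.det_smul] at h1
    have := mul_ne_zero (pow_ne_zero (Fintype.card (Fin 3)) hc) (hS (i₀ e)).det_ne_zero
    apply this
    rw [← h1]
    simp
  have hcard : ∀ i, Nat.card (R i) = Nat.card {e : E // i₀ e = i} * autNum (S i) := by
    intro i
    rw [autNum, ← Nat.card_prod]
    have hmem : ∀ (e : {e : E // i₀ e = i})
        (V : {X : IntMat // IsUnit X.det ∧ (intMap X)ᵀ * S i * intMap X = S i}),
        X₀ e.1 * V.1 ∈ R i := by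
      rintro ⟨e, rfl⟩ ⟨V, hV, hVS⟩
      rw [hR]
      refine ⟨?_, e, e.2, ?_⟩
      · rw [intMap_transform_mul, (hX₀ e).1, Matrix.mul_smul, Matrix.smul_mul, hVS]
      · rw [colLattice_mul_unimodular _ hV, (hX₀ e).2]
    refine (Nat.card_congr (Equiv.ofBijective
      (fun q : {e : E // i₀ e = i} × _ => (⟨X₀ q.1.1 * q.2.1, hmem q.1 q.2⟩ : R i)) ⟨?_, ?_⟩)).symm
    · rintro ⟨⟨e, he⟩, ⟨V, hV, hVS⟩⟩ ⟨⟨e', he'⟩, ⟨V', hV', hVS'⟩⟩ h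
      have h1 : X₀ e * V = X₀ e' * V' := congrArg Subtype.val h
      have h2 : M e = M e' := by
        rw [← (hX₀ e).2, ← (hX₀ e').2, ← colLattice_mul_unimodular _ hV, h1,
          colLattice_mul_unimodular _ hV']
      have h3 : e = e' := Subtype.ext (hM e.2 e'.2 h2)
      subst h3
      have h4 : V = V' := mul_left_cancel_of_det_ne_zero (hX₀d e) h1
      subst h4
      rfl
    · rintro ⟨X, hX⟩
      obtain ⟨h1, e, he, h2⟩ := (hR i X).1 hX
      obtain ⟨V, hV, hXV⟩ := exists_unimodular_of_colLattice_eq (hX₀d ⟨e, he⟩)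
        (((hX₀ ⟨e, he⟩).2).trans h2.symm)
      have h3 : (intMap V)ᵀ * S (i₀ ⟨e, he⟩) * intMap V = S i := by
        have := h1
        rw [hXV, intMap_transform_mul, (hX₀ ⟨e, he⟩).1, Matrix.mul_smul, Matrix.smul_mul] at this
        exact smul_right_injective _ hc this
      have h4 : i₀ ⟨e, he⟩ = i := by
        by_contra h
        exact hne _ _ h ⟨V, hV, h3⟩
      refine ⟨⟨⟨⟨e, he⟩, h4⟩, ⟨V, hV, by rw [← h4] at h3 ⊢; exact h3⟩⟩, Subtype.ext hXV.symm⟩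
  have hrep : ∀ e : E, rEval (S (i₀ e)) N = Nat.card {x // x ∈ M e ∧ qf B x = c * N} := by
    intro e
    have hq : ∀ v, qf B ((X₀ e).mulVec v) = c * qf (S (i₀ e)) v := fun v => by
      rw [qf_mulVec, (hX₀ e).1, qf_smul]
    refine Nat.card_congr (Equiv.ofBijective (fun v => ⟨(X₀ e).mulVec v.1, ?_, ?_⟩) ⟨?_, ?_⟩)
    · rw [← (hX₀ e).2]; exact mulVec_mem_colLattice _ _
    · rw [hq, v.2]
    · intro v v' h
      exact Subtype.ext (Matrix.mulVec_injective_of_det_ne_zero (hX₀d e) (congrArg Subtype.val h))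
    · rintro ⟨x, hx, hxq⟩
      rw [← (hX₀ e).2] at hx
      obtain ⟨v, rfl⟩ := mem_colLattice.1 hx
      rw [hq] at hxq
      exact ⟨⟨v, mul_left_cancel₀ hc hxq⟩, rfl⟩
  have h1 : ∀ i, (Nat.card (R i) : ℚ) / autNum (S i) * rEval (S i) N =
      ∑ e : E with i₀ e = i, (rEval (S (i₀ e)) N : ℚ) := by
    intro i
    have : (autNum (S i) : ℚ) ≠ 0 := by exact_mod_cast (hS i).autNum_pos.ne'
    rw [hcard, Finset.sum_congr rfl (fun e he => by rw [(Finset.mem_filter.1 he).2]),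
      Finset.sum_const, Nat.card_eq_fintype_card, Fintype.card_subtype]
    push_cast
    rw [nsmul_eq_mul]
    field_simp
  rw [Finset.sum_congr rfl fun i _ => h1 i, Finset.sum_fiberwise,
    ← Finset.sum_coe_sort E fun e => (Nat.card {x // x ∈ M e ∧ qf B x = c * N} : ℚ)]
  exact Finset.sum_congr rfl fun e _ => by rw [hrep]

lemma addSubgroup_eq_of_le_of_index_eq {G : Type*} [AddGroup G] {H K : AddSubgroup G} (h : H ≤ K)
    (h0 : H.index ≠ 0) (hi : H.index = K.index) : H = K := by
  have : H.FiniteIndex := ⟨h0⟩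
  by_contra hne
  exact (AddSubgroup.index_strictAnti (lt_of_le_of_ne h hne)).ne hi.symm

lemma qf_eq_zero_of_zero (A : RatMat) : qf A 0 = 0 := by
  simp [qf, dotProduct]

/-- Summing over a family of lattices the number of vectors `x` with `f(x) = p² m`, when the number
of lattices through `x` only depends on whether `x` is divisible by `p`. -/
lemma sum_card_mem_eq {p : ℕ} (hp : p ≠ 0) {A : RatMat} (hA : PosDef3 A) {ι : Type*} {E : Finset ι}
    {M : ι → AddSubgroup (Fin 3 → ℤ)} {m : ℤ} {α β : ℚ}
    (hα : ∀ x : Fin 3 → ℤ, (Nat.card {e // e ∈ E ∧ (p : ℤ) • x ∈ M e} : ℚ) = α)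
    (hβ : ∀ x : Fin 3 → ℤ, qf A x = (p : ℚ) ^ 2 * m → (¬ ∃ y : Fin 3 → ℤ, x = (p : ℤ) • y) →
      (Nat.card {e // e ∈ E ∧ x ∈ M e} : ℚ) = β) :
    ∑ e ∈ E, (Nat.card {x // x ∈ M e ∧ qf A x = (p : ℚ) ^ 2 * m} : ℚ) =
      β * rEval A ((p : ℤ) ^ 2 * m) + (α - β) * rEval A m := by
  classical
  set Q := (hA.finite_level ((p : ℚ) ^ 2 * m)).toFinset with hQ
  have hQm : ∀ x, x ∈ Q ↔ qf A x = (p : ℚ) ^ 2 * m := fun x => by simp [hQ]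
  have hpq : (p : ℚ) ≠ 0 := by exact_mod_cast hp
  have hpz : (p : ℤ) ≠ 0 := by exact_mod_cast hp
  have h1 : ∀ e, Nat.card {x // x ∈ M e ∧ qf A x = (p : ℚ) ^ 2 * m} =
      (Q.filter fun x => x ∈ M e).card := fun e =>
    Nat.subtype_card _ fun x => by rw [Finset.mem_filter, hQm, and_comm]
  have h2 : ∀ x, (Nat.card {e // e ∈ E ∧ x ∈ M e}) = (E.filter fun e => x ∈ M e).card := fun x =>
    Nat.subtype_card _ fun e => Finset.mem_filter
  have h3 : rEval A ((p : ℤ) ^ 2 * m) = Q.card :=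
    Nat.subtype_card _ fun x => by rw [hQm]; push_cast; rfl
  have h4 : rEval A m = (Q.filter fun x => ∃ y : Fin 3 → ℤ, x = (p : ℤ) • y).card := by
    have hinj : Function.Injective fun y : Fin 3 → ℤ => (p : ℤ) • y := smul_right_injective _ hpz
    refine (Nat.card_congr (Equiv.Set.image _ {x | qf A x = m} hinj)).trans ?_
    refine Nat.subtype_card _ fun x => ?_
    rw [Finset.mem_filter, hQm]
    constructor
    · rintro ⟨hx, y, rfl⟩
      refine ⟨y, ?_, rfl⟩
      rw [qf_zsmul] at hx
      exact mul_left_cancel₀ (pow_ne_zero 2 hpq) (by simpa using hx)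
    · rintro ⟨y, hy, rfl⟩
      refine ⟨?_, y, rfl⟩
      change qf A ((p : ℤ) • y) = _
      rw [qf_zsmul, show qf A y = m from hy]
      simp
  simp only [h1, h2] at *
  have h5 := Finset.sum_card_bipartiteAbove_eq_sum_card_bipartiteBelow
    (fun e x => x ∈ M e) (s := E) (t := Q)
  simp only [Finset.bipartiteAbove, Finset.bipartiteBelow] at h5
  have h6 : ∀ x ∈ Q, ((E.filter fun e => x ∈ M e).card : ℚ) =
      if ∃ y : Fin 3 → ℤ, x = (p : ℤ) • y then α else β := by
    intro x hx
    split_ifs with h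
    · obtain ⟨y, rfl⟩ := h
      exact hα y
    · exact hβ x ((hQm x).1 hx) h
  have h7 : (∑ e ∈ E, ((Q.filter fun x => x ∈ M e).card : ℚ)) =
      ∑ x ∈ Q, ((E.filter fun e => x ∈ M e).card : ℚ) := by exact_mod_cast h5
  rw [h7, Finset.sum_congr rfl h6, Finset.sum_ite, Finset.sum_const, Finset.sum_const, h3, h4,
    ← Finset.card_filter_add_card_filter_not (s := Q) fun x => ∃ y : Fin 3 → ℤ, x = (p : ℤ) • y]
  simp only [nsmul_eq_mul]
  push_cast
  ring

namespace LocalCoord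

variable {p : ℕ} [Fact p.Prime] {A : RatMat} {η : ℤ_[p]} (L : LocalCoord p A η)

lemma pre_span_le {N : AddSubgroup (Fin 3 → ℤ)} (hN : ∀ y : Fin 3 → ℤ, (p : ℤ) • y ∈ N)
    {s : Set (Fin 3 → ZMod p)} (hs : ∀ w ∈ s, ∃ x ∈ N, L.red x = w) :
    L.pre (Submodule.span (ZMod p) s) ≤ N := by
  have h1 : Submodule.span (ZMod p) s ≤ AddSubgroup.toZModSubmodule p (N.map L.red) := by
    rw [Submodule.span_le]
    exact fun w hw => hs w hw
  intro z hz
  obtain ⟨x, hx, hxz⟩ := h1 (L.mem_pre.1 hz)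
  obtain ⟨y, hy⟩ := L.red_eq_zero.1 (show L.red (z - x) = 0 by rw [map_sub, hxz, sub_self])
  rw [← sub_add_cancel z x, hy]
  exact N.add_mem (hN y) hx

lemma smul_mem_pre (W : Submodule (ZMod p) (Fin 3 → ZMod p)) (y : Fin 3 → ℤ) :
    (p : ℤ) • y ∈ L.pre W := by
  rw [L.mem_pre, L.red_eq_zero.2 ⟨y, rfl⟩]
  exact W.zero_mem

end LocalCoord

/-- The reductions of the vectors with values divisible by `p²` in a form `u₀u₁ + pεu₂²`. -/
lemma LocalCoord.red_eq_zero_of_sq_dvd {p : ℕ} [Fact p.Prime] {ε : ℤ_[p]ˣ} {T : RatMat}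
    (L : LocalCoord p T (p * ε)) {x : Fin 3 → ℤ} {m : ℤ} (hx : qf T x = (p : ℚ) ^ 2 * m)
    (h0 : L.red x 0 = 0) (h1 : L.red x 1 = 0) : L.red x = 0 := by
  obtain ⟨a, ha⟩ := L.red_apply_eq_zero.1 h0
  obtain ⟨b, hb⟩ := L.red_apply_eq_zero.1 h1
  have hq := L.qf_int (k := (p : ℤ) ^ 2 * m) (by rw [hx]; push_cast; rfl)
  rw [ha, hb] at hq
  push_cast at hq
  have hp0 : (p : ℤ_[p]) ≠ 0 := PadicInt.prime_p.ne_zero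
  have h2 : (p : ℤ_[p]) * (m - a * b) = ε * L.u x 2 ^ 2 := by
    apply mul_left_cancel₀ hp0
    linear_combination hq
  have h3 : (p : ℤ_[p]) ∣ L.u x 2 := by
    have : (p : ℤ_[p]) ∣ ε * L.u x 2 ^ 2 := ⟨_, h2.symm⟩
    exact PadicInt.prime_p.dvd_of_dvd_pow ((ε.isUnit.dvd_mul_left).1 this)
  ext i
  fin_cases i
  · exact h0
  · exact h1
  · exact L.red_apply_eq_zero.2 h3

/-- Representatives of the lines, other than the third axis, on which `u₀ u₁` vanishes. -/
def lineReps (p : ℕ) [Fact p.Prime] : Finset (Fin 3 → ZMod p) :=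
  (Finset.univ.image fun t => ![1, 0, t]) ∪ Finset.univ.image fun t => ![0, 1, t]

lemma mem_lineReps {p : ℕ} [Fact p.Prime] {w : Fin 3 → ZMod p} :
    w ∈ lineReps p ↔ (w 0 = 1 ∧ w 1 = 0) ∨ (w 0 = 0 ∧ w 1 = 1) := by
  rw [lineReps, Finset.mem_union, Finset.mem_image, Finset.mem_image]
  constructor
  · rintro (⟨t, -, rfl⟩ | ⟨t, -, rfl⟩) <;> simp
  · rintro (⟨h0, h1⟩ | ⟨h0, h1⟩)
    · exact Or.inl ⟨w 2, Finset.mem_univ _, by ext i; fin_cases i <;> simp [h0, h1]⟩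
    · exact Or.inr ⟨w 2, Finset.mem_univ _, by ext i; fin_cases i <;> simp [h0, h1]⟩

lemma card_lineReps (p : ℕ) [Fact p.Prime] : (lineReps p).card = 2 * p := by
  rw [lineReps, Finset.card_union_of_disjoint, Finset.card_image_of_injective,
    Finset.card_image_of_injective, Finset.card_univ, ZMod.card, two_mul]
  · intro s t h
    simpa using congrFun h 2
  · intro s t h
    simpa using congrFun h 2
  · rw [Finset.disjoint_left]
    intro w h h'
    obtain ⟨t, -, rfl⟩ := Finset.mem_image.1 h
    obtain ⟨s, -, hs⟩ := Finset.mem_image.1 h'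
    simpa using congrFun hs 0

lemma ne_zero_of_mem_lineReps {p : ℕ} [Fact p.Prime] {w : Fin 3 → ZMod p} (h : w ∈ lineReps p) :
    w ≠ 0 := by
  rintro rfl
  simpa using mem_lineReps.1 h

lemma eq_of_smul_mem_lineReps {p : ℕ} [Fact p.Prime] {w w' v : Fin 3 → ZMod p}
    (hw : w ∈ lineReps p) (hw' : w' ∈ lineReps p) {a b : ZMod p} (h : a • w = v) (h' : b • w' = v)
    (hv : v ≠ 0) : w = w' := by
  have ha : a ≠ 0 := by rintro rfl; exact hv (by rw [← h, zero_smul])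
  have hb : b ≠ 0 := by rintro rfl; exact hv (by rw [← h', zero_smul])
  have e0 := congrFun (h.trans h'.symm) 0
  have e1 := congrFun (h.trans h'.symm) 1
  simp only [Pi.smul_apply, smul_eq_mul] at e0 e1
  have hab : a = b := by
    rcases mem_lineReps.1 hw with ⟨h0, h1⟩ | ⟨h0, h1⟩ <;>
      rcases mem_lineReps.1 hw' with ⟨h0', h1'⟩ | ⟨h0', h1'⟩ <;>
      simp_all
  subst hab
  exact smul_right_injective _ ha (h.trans h'.symm)

lemma exists_mem_lineReps {p : ℕ} [Fact p.Prime] {v : Fin 3 → ZMod p} (hv : v 0 * v 1 = 0)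
    (hne : ¬ (v 0 = 0 ∧ v 1 = 0)) :
    ∃ w ∈ lineReps p, ∃ a : ZMod p, a ≠ 0 ∧ a • w = v := by
  by_cases h0 : v 0 = 0
  · have h1 : v 1 ≠ 0 := fun h1 => hne ⟨h0, h1⟩
    refine ⟨(v 1)⁻¹ • v, mem_lineReps.2 (Or.inr ?_), v 1, h1, ?_⟩
    · simp [h0, h1]
    · rw [smul_smul, mul_inv_cancel₀ h1, one_smul]
  · have h1 : v 1 = 0 := (mul_eq_zero.1 hv).resolve_left h0
    refine ⟨(v 0)⁻¹ • v, mem_lineReps.2 (Or.inl ?_), v 0, h0, ?_⟩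
    · simp [h0, h1]
    · rw [smul_smul, mul_inv_cancel₀ h0, one_smul]

lemma natCard_lineReps_through {p : ℕ} [Fact p.Prime] {v : Fin 3 → ZMod p} (hv : v 0 * v 1 = 0)
    (hne : ¬ (v 0 = 0 ∧ v 1 = 0)) :
    Nat.card {w // w ∈ lineReps p ∧ v ∈ Submodule.span (ZMod p) {w}} = 1 := by
  obtain ⟨w, hw, a, ha, haw⟩ := exists_mem_lineReps hv hne
  have hv0 : v ≠ 0 := by rintro rfl; simp at hne
  rw [← Finset.card_singleton w]
  refine Nat.subtype_card _ fun w' => ?_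
  rw [Finset.mem_singleton, Submodule.mem_span_singleton]
  constructor
  · rintro rfl
    exact ⟨hw, a, haw⟩
  · rintro ⟨hw', b, hb⟩
    exact eq_of_smul_mem_lineReps hw' hw hb haw hv0

lemma HalfIntegral.exists_qf {A : RatMat} (hA : HalfIntegral A) (hs : A.IsSymm) (x : Fin 3 → ℤ) :
    ∃ k : ℤ, qf A x = k :=
  (halfIntegral_iff hs).1 hA x

lemma HalfIntegral.exists_polar3 {A : RatMat} (hA : HalfIntegral A) (hs : A.IsSymm)
    (x y : Fin 3 → ℤ) : ∃ k : ℤ, polar3 A x y = k := by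
  obtain ⟨a, ha⟩ := hA.exists_qf hs (x + y)
  obtain ⟨b, hb⟩ := hA.exists_qf hs x
  obtain ⟨c, hc⟩ := hA.exists_qf hs y
  exact ⟨a - b - c, by rw [polar3, ha, hb, hc]; push_cast; rfl⟩

lemma polar3_zsmul_left {A : RatMat} (hA : A.IsSymm) (k : ℤ) (x y : Fin 3 → ℤ) :
    polar3 A (k • x) y = k * polar3 A x y := by
  have : (fun i => (((k • x) i : ℤ) : ℚ)) = (k : ℚ) • fun i => (x i : ℚ) := by
    ext i; simp
  rw [polar3_eq hA, polar3_eq hA, this, smul_dotProduct, smul_eq_mul]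
  ring

lemma natAbs_det_of_isometry {p k : ℕ} {T S : RatMat} (hT : T.det ≠ 0) {c : ℚ}
    (hd : c ^ 3 * |S.det| = p ^ (2 * k) * |T.det|) (hc : 0 ≤ c) {X : IntMat}
    (hX : (intMap X)ᵀ * T * intMap X = c • S) : X.det.natAbs = p ^ k := by
  have h1 := congrArg (fun M => |Matrix.det M|) hX
  simp only [det_transform, Matrix.det_smul, abs_mul, Fintype.card_fin, abs_pow,
    abs_of_nonneg hc, hd] at h1
  have h2 : |(X.det : ℚ)| ^ 2 = ((p : ℚ) ^ k) ^ 2 := by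
    rw [← pow_mul, mul_comm k]
    exact mul_right_cancel₀ (abs_ne_zero.2 hT) h1
  have h3 : |(X.det : ℚ)| = (p : ℚ) ^ k :=
    (pow_left_inj₀ (abs_nonneg _) (by positivity) two_ne_zero).1 h2
  have h4 : ((X.det.natAbs : ℤ) : ℚ) = ((p ^ k : ℕ) : ℚ) := by
    rw [Int.natCast_natAbs, Int.cast_abs, Nat.cast_pow]; exact h3
  exact_mod_cast h4

lemma exists_mul_eq_smul_one_iff {p : ℕ} {X : IntMat} (hX : X.det ≠ 0) :
    (∃ U : IntMat, X * U = (p : ℤ) • (1 : IntMat) ∧ U * X = (p : ℤ) • (1 : IntMat)) ↔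
      ∀ y : Fin 3 → ℤ, (p : ℤ) • y ∈ colLattice X := by
  constructor
  · rintro ⟨U, hU, -⟩ y
    refine mem_colLattice.2 ⟨U.mulVec y, ?_⟩
    rw [Matrix.mulVec_mulVec, hU, Matrix.smul_mulVec, Matrix.one_mulVec]
  · intro h
    obtain ⟨U, hU⟩ := exists_mul_of_forall_mulVec_mem (X := (p : ℤ) • (1 : IntMat)) (Y := X)
      fun c => by rw [Matrix.smul_mulVec, Matrix.one_mulVec]; exact h c
    refine ⟨U, hU.symm, mul_left_cancel_of_det_ne_zero hX ?_⟩
    rw [← Matrix.mul_assoc, ← hU, Matrix.smul_mul, Matrix.one_mul, Matrix.mul_smul, Matrix.mul_one]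

section Lines

variable {p : ℕ} [Fact p.Prime] {ε : ℤ_[p]ˣ} {T S : RatMat}

lemma toZMod_p_mul (x : ℤ_[p]) : PadicInt.toZMod ((p : ℤ_[p]) * x) = 0 :=
  toZMod_eq_zero_iff.2 (dvd_mul_right _ _)

lemma toZMod_p_sq_mul (x : ℤ_[p]) : PadicInt.toZMod ((p : ℤ_[p]) ^ 2 * x) = 0 :=
  toZMod_eq_zero_iff.2 ((dvd_pow_self _ two_ne_zero).mul_right _)

lemma LocalCoord.pre_line_index {A : RatMat} {η : ℤ_[p]} (L : LocalCoord p A η)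
    {w : Fin 3 → ZMod p} (hw : w ≠ 0) :
    (L.pre (Submodule.span (ZMod p) {w})).index = p ^ 2 := by
  have h := L.pre_index (Submodule.span (ZMod p) {w})
  rw [finrank_span_singleton hw, pow_one, pow_succ' p 2] at h
  exact Nat.eq_of_mul_eq_mul_left (Fact.out : p.Prime).pos h

/-- The sublattices of `T` isometric to the `p`-scaling of a lattice of type `H ⊕ [p² ε]` and
containing `p ℤ³` are given by lines. -/
lemma exists_line_of_isometry (LT : LocalCoord p T (p * ε))
    (hS : PosDef3 S) (hSh : HalfIntegral S) (LS : LocalCoord p S ((p : ℤ_[p]) ^ 2 * ε))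
    {X : IntMat} (hX : (intMap X)ᵀ * T * intMap X = (p : ℚ) • S) (hXd : X.det.natAbs = p ^ 2)
    (hpX : ∀ y : Fin 3 → ℤ, (p : ℤ) • y ∈ colLattice X) :
    ∃ w ∈ lineReps p, colLattice X = LT.pre (Submodule.span (ZMod p) {w}) := by
  have hp := (Fact.out : p.Prime)
  have hp0 : (p : ℤ_[p]) ≠ 0 := PadicInt.prime_p.ne_zero
  have hXd0 : X.det ≠ 0 := fun h => by
    rw [h] at hXd
    exact pow_ne_zero 2 hp.ne_zero hXd.symm
  obtain ⟨a, ha⟩ := LS.red_surjective ![1, 0, 0]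
  obtain ⟨b, hb⟩ := LS.red_surjective ![0, 1, 0]
  have hsq : ∀ c, LS.red c 0 * LS.red c 1 = 0 → ∃ k : ℤ, qf T (X.mulVec c) = (p : ℚ) ^ 2 * k := by
    intro c hc
    obtain ⟨k, hk⟩ := hSh.exists_qf hS.1 c
    have h1 := LS.qf_mod hk
    rw [hc, toZMod_p_sq_mul, zero_mul, add_zero, intCast_zmod_eq_zero_iff] at h1
    obtain ⟨k', rfl⟩ := h1
    refine ⟨k', ?_⟩
    rw [qf_mulVec, hX, qf_smul, hk]
    push_cast
    ring
  obtain ⟨ka, hka⟩ := hsq a (by simp [ha])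
  obtain ⟨kb, hkb⟩ := hsq b (by simp [hb])
  have key : ∃ x ∈ colLattice X, ¬ (LT.red x 0 = 0 ∧ LT.red x 1 = 0) := by
    by_contra hcon
    push Not at hcon
    have h1 : ∀ c k, qf T (X.mulVec c) = (p : ℚ) ^ 2 * (k : ℤ) →
        ∀ i, (p : ℤ_[p]) ∣ LT.u (X.mulVec c) i := by
      intro c k hk i
      obtain ⟨h0, h1⟩ := hcon _ (mulVec_mem_colLattice X c)
      exact LT.red_apply_eq_zero.1 (congrFun (LT.red_eq_zero_of_sq_dvd hk h0 h1) i)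
    choose x hx using h1 a ka hka
    choose y hy using h1 b kb hkb
    obtain ⟨l, hl⟩ := hSh.exists_polar3 hS.1 a b
    have h2 := LS.polar_mod hl
    simp only [ha, hb] at h2
    have h3 := LT.polar_int (x := X.mulVec a) (y := X.mulVec b) (k := p * l) (by
      rw [polar3_mulVec, hX, polar3_smul, hl]; push_cast; rfl)
    simp only [hx, hy] at h3
    push_cast at h3
    have h4 : (p : ℤ_[p]) ∣ l := by
      refine ⟨x 0 * y 1 + y 0 * x 1 + 2 * p * ε * x 2 * y 2, mul_left_cancel₀ hp0 ?_⟩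
      linear_combination h3
    rw [natCast_dvd_intCast_padicInt, ← intCast_zmod_eq_zero_iff, h2] at h4
    simp at h4
  obtain ⟨x, hx, hne⟩ := key
  have h0 : LT.red x 0 * LT.red x 1 = 0 := by
    obtain ⟨c, rfl⟩ := mem_colLattice.1 hx
    obtain ⟨k, hk⟩ := hSh.exists_qf hS.1 c
    have := LT.qf_mod (x := X.mulVec c) (k := p * k) (by
      rw [qf_mulVec, hX, qf_smul, hk]; push_cast; rfl)
    rw [toZMod_p_mul, zero_mul, add_zero] at this
    rw [← this]
    simp
  obtain ⟨w, hw, r, hr, hrw⟩ := exists_mem_lineReps h0 hne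
  refine ⟨w, hw, (addSubgroup_eq_of_le_of_index_eq ?_ ?_ ?_).symm⟩
  · refine LT.pre_span_le hpX fun v hv => ?_
    rw [Set.mem_singleton_iff.1 hv]
    refine ⟨(r⁻¹).val • x, nsmul_mem hx _, ?_⟩
    rw [map_nsmul, ← hrw, ← Nat.cast_smul_eq_nsmul (ZMod p), ZMod.natCast_zmod_val, smul_smul,
      inv_mul_cancel₀ hr, one_smul]
  · rw [LT.pre_line_index (ne_zero_of_mem_lineReps hw)]
    exact pow_ne_zero 2 hp.ne_zero
  · rw [LT.pre_line_index (ne_zero_of_mem_lineReps hw), colLattice_index hXd0, hXd]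

lemma exists_basis_of_line (hT : PosDef3 T) (hTh : HalfIntegral T)
    (hTp : ZpEquivTo p T (Hblock p ((p : ℚ_[p]) * ((ε : ℤ_[p]) : ℚ_[p]))))
    (LT : LocalCoord p T (p * ε)) {w : Fin 3 → ZMod p} (hw : w ∈ lineReps p) :
    ∃ (X : IntMat) (A : RatMat), colLattice X = LT.pre (Submodule.span (ZMod p) {w}) ∧
      (intMap X)ᵀ * T * intMap X = (p : ℚ) • A ∧ HalfIntegral A ∧ PosDef3 A ∧
      ZpEquivTo p A (Hblock p ((p : ℚ_[p]) ^ 2 * ((ε : ℤ_[p]) : ℚ_[p]))) ∧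
      ∀ q : ℕ, ∀ hq : q.Prime, q ≠ p → @ZqEquiv q ⟨hq⟩ A ((p : ℚ) • T) := by
  have hp := (Fact.out : p.Prime)
  have hpq : (p : ℚ) ≠ 0 := by exact_mod_cast hp.ne_zero
  have hidx := LT.pre_line_index (ne_zero_of_mem_lineReps hw)
  obtain ⟨X, hX, hXd⟩ := exists_colLattice_eq (hidx ▸ pow_ne_zero 2 hp.ne_zero)
  rw [hidx] at hXd
  have hA : (p : ℚ)⁻¹ • ((intMap X)ᵀ * T * intMap X) = (p : ℚ)⁻¹ • ((intMap X)ᵀ * T * intMap X) :=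
    rfl
  have hAh : HalfIntegral ((p : ℚ)⁻¹ • ((intMap X)ᵀ * T * intMap X)) := by
    rw [halfIntegral_iff ((isSymm_transpose_mul_mul hT.1 _).smul _)]
    intro c
    obtain ⟨k, hk⟩ := hTh.exists_qf hT.1 (X.mulVec c)
    have h1 := LT.qf_mod hk
    have h2 : X.mulVec c ∈ LT.pre (Submodule.span (ZMod p) {w}) := hX ▸ mulVec_mem_colLattice X c
    obtain ⟨r, hr⟩ := Submodule.mem_span_singleton.1 (LT.mem_pre.1 h2)
    have h3 : (k : ZMod p) = 0 := by
      rw [h1, ← hr, toZMod_p_mul]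
      rcases mem_lineReps.1 hw with ⟨h0, h1⟩ | ⟨h0, h1⟩ <;> simp [h0, h1]
    obtain ⟨k', rfl⟩ := intCast_zmod_eq_zero_iff.1 h3
    refine ⟨k', ?_⟩
    rw [qf_smul, ← qf_mulVec, hk]
    push_cast
    field_simp
  obtain ⟨y, hy⟩ := LT.red_surjective ![w 1, w 0, 0]
  obtain ⟨x, hx⟩ := LT.red_surjective w
  have hxX : x ∈ colLattice X := by
    rw [hX, LT.mem_pre, hx]
    exact Submodule.mem_span_singleton_self w
  have hyX : (p : ℤ) • y ∈ colLattice X := hX ▸ LT.smul_mem_pre _ y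
  obtain ⟨a, ha⟩ := mem_colLattice.1 hxX
  obtain ⟨b, hb⟩ := mem_colLattice.1 hyX
  obtain ⟨k, hk⟩ := hTh.exists_qf hT.1 y
  obtain ⟨l, hl⟩ := hTh.exists_polar3 hT.1 y x
  obtain ⟨h1, h2, h3⟩ := genus_of_sublattice hT hTp hXd hA hAh (b := b) (a := a) (k := k) (l := l)
    (by
      rw [qf_smul, ← qf_mulVec, ← hb, qf_zsmul, hk]
      push_cast
      field_simp)
    (by
      rw [polar3_smul, ← polar3_mulVec, ← hb, ← ha, polar3_zsmul_left hT.1, hl]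
      push_cast
      field_simp)
    (by
      rw [← intCast_zmod_eq_zero_iff, LT.polar_mod hl, hx, hy]
      rcases mem_lineReps.1 hw with ⟨h0, h1⟩ | ⟨h0, h1⟩ <;> simp [h0, h1])
  refine ⟨X, _, hX, ?_, hAh, h1, h2, h3⟩
  rw [smul_smul, mul_inv_cancel₀ hpq, one_smul]

end Lines

/-- The weighted sum over the genus `H ⊕ [p² ε]` of the numbers of primitive embeddings, evaluated
by counting lines modulo `p`. -/
lemma sum_rtilde {p : ℕ} [Fact p.Prime] {ε : ℤ_[p]ˣ} {T : RatMat} (hT : PosDef3 T)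
    (hTh : HalfIntegral T)
    (hTp : ZpEquivTo p T (Hblock p ((p : ℚ_[p]) * ((ε : ℤ_[p]) : ℚ_[p]))))
    {g : ℕ} {St : Fin g → RatMat} (hSt : ∀ i, PosDef3 (St i) ∧ HalfIntegral (St i))
    (hStne : ∀ i j, i ≠ j → ¬ ZEquiv (St i) (St j))
    (hStp : ∀ i, ZpEquivTo p (St i) (Hblock p ((p : ℚ_[p]) ^ 2 * ((ε : ℤ_[p]) : ℚ_[p]))))
    (hStdet : ∀ i, |(St i).det| = |p * T.det|)
    (hStcomp : ∀ A : RatMat, PosDef3 A → HalfIntegral A →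
      ZpEquivTo p A (Hblock p ((p : ℚ_[p]) ^ 2 * ((ε : ℤ_[p]) : ℚ_[p]))) →
      (∀ q : ℕ, ∀ hq : q.Prime, q ≠ p → @ZqEquiv q ⟨hq⟩ A ((p : ℚ) • T)) →
      ∃ i, ZEquiv A (St i)) (m : ℤ) :
    ∑ i, (rtilde p (St i) T : ℚ) / autNum (St i) * rEval (St i) (p * m) =
      rEval T ((p : ℤ) ^ 2 * m) + (2 * p - 1) * rEval T m := by
  have hp := (Fact.out : p.Prime)
  have hpq : (p : ℚ) ≠ 0 := by exact_mod_cast hp.ne_zero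
  obtain ⟨LT⟩ := exists_localCoord_of_zpEquivTo (A := T) (η := (p : ℤ_[p]) * (ε : ℤ_[p])) (by simpa using hTp)
  have hline : ∀ w ∈ lineReps p, w ≠ 0 := fun w => ne_zero_of_mem_lineReps
  have h1 := sum_orbits (fun i => (hSt i).1) hStne (B := T) (c := p) hpq (E := lineReps p)
    (M := fun w => LT.pre (Submodule.span (ZMod p) {w}))
    (R := fun i => {X | (intMap X)ᵀ * T * intMap X = (p : ℚ) • St i ∧ ∃ U : IntMat,
      X * U = (p : ℤ) • (1 : IntMat) ∧ U * X = (p : ℤ) • (1 : IntMat)}) ?_ ?_ ?_ (p * m)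
  · refine h1.trans ?_
    have h2 := sum_card_mem_eq hp.ne_zero hT (E := lineReps p)
      (M := fun w => LT.pre (Submodule.span (ZMod p) {w})) (m := m) (α := 2 * p) (β := 1) ?_ ?_
    · rw [one_mul] at h2
      rw [← h2]
      have : (p : ℚ) * ((p * m : ℤ) : ℚ) = p ^ 2 * m := by push_cast; ring
      rw [this]
    · intro x
      rw [show (2 * p : ℚ) = ((2 * p : ℕ) : ℚ) by push_cast; rfl, ← card_lineReps p]
      congr 1
      exact Nat.subtype_card _ fun w => ⟨fun h => ⟨h, LT.smul_mem_pre _ x⟩, fun h => h.1⟩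
    · intro x hx hxp
      rw [← LT.red_eq_zero] at hxp
      have h0 := LT.qf_mod (x := x) (k := p ^ 2 * m) (by rw [hx]; push_cast; rfl)
      rw [toZMod_p_mul, zero_mul, add_zero] at h0
      have := natCard_lineReps_through (v := LT.red x) (by rw [← h0]; simp)
        fun h => hxp (LT.red_eq_zero_of_sq_dvd hx h.1 h.2)
      exact_mod_cast this
  · intro w hw w' hw' h
    have h1 := LT.pre_injective h
    have h2 : w ∈ Submodule.span (ZMod p) {w'} := h1 ▸ Submodule.mem_span_singleton_self w
    obtain ⟨r, hr⟩ := Submodule.mem_span_singleton.1 h2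
    exact eq_of_smul_mem_lineReps hw hw' (one_smul _ w) hr (hline w hw)
  · intro i X
    rw [Set.mem_ofPred_eq]
    refine and_congr_right fun hX => ?_
    have hXd : X.det.natAbs = p ^ 2 := natAbs_det_of_isometry hT.det_ne_zero (by
      rw [hStdet, abs_mul, Nat.abs_cast]; ring) (Nat.cast_nonneg p) hX
    have hXd0 : X.det ≠ 0 := fun h => by
      rw [h] at hXd
      exact pow_ne_zero 2 hp.ne_zero hXd.symm
    rw [exists_mul_eq_smul_one_iff hXd0]
    constructor
    · intro h
      obtain ⟨LS⟩ := exists_localCoord_of_zpEquivTo (A := St i) (η := (p : ℤ_[p]) ^ 2 * (ε : ℤ_[p]))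
        (by simpa using hStp i)
      exact exists_line_of_isometry LT (hSt i).1 (hSt i).2 LS hX hXd h
    · rintro ⟨w, -, hw⟩ y
      rw [hw]
      exact LT.smul_mem_pre _ y
  · intro w hw
    obtain ⟨X, A, hX, hXA, hAh, hA, hAp, hAq⟩ := exists_basis_of_line hT hTh hTp LT hw
    obtain ⟨i, V, hV, hVA⟩ := hStcomp A hA hAh hAp hAq
    refine ⟨i, X * V, ?_, by rw [colLattice_mul_unimodular _ hV, hX]⟩
    rw [intMap_transform_mul, hXA, Matrix.mul_smul, Matrix.smul_mul, hVA]

namespace LocalCoord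

variable {p : ℕ} [Fact p.Prime] {A : RatMat} {η : ℤ_[p]} (L : LocalCoord p A η)

/-- Exchange of the two isotropic coordinates. -/
def swap : LocalCoord p A η where
  u :=
    { toFun := fun x => ![L.u x 1, L.u x 0, L.u x 2]
      map_zero' := by ext i; fin_cases i <;> simp
      map_add' := fun x y => by ext i; fin_cases i <;> simp }
  qf_eq x := by rw [L.qf_eq x, mul_comm (L.u x 0)]; rfl
  prim x hx := L.prim x fun i => by
    fin_cases i
    · exact hx 1
    · exact hx 0
    · exact hx 2

lemma swap_red_zero (x : Fin 3 → ℤ) : L.swap.red x 0 = L.red x 1 := rfl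

/-- The sublattice where the first coordinate is divisible by `p`. -/
def half : AddSubgroup (Fin 3 → ℤ) :=
  ((Pi.evalAddMonoidHom (fun _ : Fin 3 => ZMod p) 0).comp L.red).ker

lemma mem_half {x : Fin 3 → ℤ} : x ∈ L.half ↔ L.red x 0 = 0 := Iff.rfl

lemma half_index : L.half.index = p := by
  have hs : Function.Surjective ((Pi.evalAddMonoidHom (fun _ : Fin 3 => ZMod p) 0).comp L.red) :=
    fun a => by
      obtain ⟨x, hx⟩ := L.red_surjective ![a, 0, 0]
      exact ⟨x, by simp [hx]⟩
  rw [half, AddSubgroup.index_ker, AddMonoidHom.range_eq_top.2 hs]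
  simp

lemma swap_half_ne : L.half ≠ L.swap.half := fun h => by
  obtain ⟨x, hx⟩ := L.red_surjective ![1, 0, 0]
  have h1 : x ∈ L.half := by
    rw [h, mem_half, swap_red_zero, hx]
    rfl
  rw [mem_half, hx] at h1
  exact one_ne_zero h1

end LocalCoord

section HalfLattice

variable {p : ℕ} [Fact p.Prime] {ε : ℤ_[p]ˣ} {T : RatMat}

lemma LocalCoord.exists_qf_of_mem_half (hT : PosDef3 T) (hTh : HalfIntegral T)
    (L : LocalCoord p T (p * ε)) {x : Fin 3 → ℤ} (hx : x ∈ L.half) :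
    ∃ k : ℤ, qf T x = (p : ℚ) * k := by
  obtain ⟨k, hk⟩ := hTh.exists_qf hT.1 x
  have h1 := L.qf_mod hk
  rw [L.mem_half.1 hx, zero_mul, toZMod_p_mul, zero_mul, add_zero, intCast_zmod_eq_zero_iff] at h1
  obtain ⟨k', rfl⟩ := h1
  exact ⟨k', by rw [hk]; push_cast; rfl⟩

/-- The two sublattices of index `p` with values in `pℤ` are the coordinate ones. -/
lemma exists_localCoord_half (hT : PosDef3 T) (hTh : HalfIntegral T) (L : LocalCoord p T (p * ε))
    {Γ₁ Γ₂ : AddSubgroup (Fin 3 → ℤ)}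
    (hΓonly : ∀ N : AddSubgroup (Fin 3 → ℤ),
      (N.index = p ∧ ∀ x ∈ N, ∃ k : ℤ, qf T x = (p : ℚ) * k) → N = Γ₁ ∨ N = Γ₂) :
    ∃ L' : LocalCoord p T (p * ε), Γ₁ = L'.half ∧ Γ₂ = L'.swap.half := by
  have h1 := hΓonly L.half ⟨L.half_index, fun x hx => L.exists_qf_of_mem_half hT hTh hx⟩
  have h2 := hΓonly L.swap.half
    ⟨L.swap.half_index, fun x hx => L.swap.exists_qf_of_mem_half hT hTh hx⟩
  have hne := L.swap_half_ne
  rcases h1 with h1 | h1 <;> rcases h2 with h2 | h2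
  · exact absurd (h1.trans h2.symm) hne
  · exact ⟨L, h1.symm, h2.symm⟩
  · exact ⟨L.swap, h2.symm, h1.symm⟩
  · exact absurd (h1.trans h2.symm) hne

lemma exists_localCoord_of_half (L : LocalCoord p T (p * ε)) {Y : IntMat} (hYd : Y.det ≠ 0)
    (hY : colLattice Y = L.half) :
    Nonempty (LocalCoord p ((p : ℚ)⁻¹ • ((intMap Y)ᵀ * T * intMap Y)) (ε : ℤ_[p])) := by
  have hp0 : (p : ℤ_[p]) ≠ 0 := PadicInt.prime_p.ne_zero
  have hpq : (p : ℚ_[p]) ≠ 0 := by exact_mod_cast (Fact.out : p.Prime).ne_zero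
  have hdiv : ∀ c, ∃ a, L.u (Y.mulVec c) 0 = p * a := fun c =>
    L.red_apply_eq_zero.1 (L.mem_half.1 (hY ▸ mulVec_mem_colLattice Y c))
  choose d hd using hdiv
  have hadd : ∀ c c', d (c + c') = d c + d c' := fun c c' => mul_left_cancel₀ hp0 (by
    rw [mul_add, ← hd, ← hd, ← hd, Matrix.mulVec_add, map_add, Pi.add_apply])
  let u : (Fin 3 → ℤ) →+ (Fin 3 → ℤ_[p]) :=
    AddMonoidHom.mk' (fun c => ![d c, L.u (Y.mulVec c) 1, L.u (Y.mulVec c) 2]) fun c c' => by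
      ext i
      fin_cases i <;> simp [hadd, Matrix.mulVec_add]
  refine ⟨⟨u, fun c => ?_, fun c hc => ?_⟩⟩
  · rw [qf_smul, ← qf_mulVec, Rat.cast_mul, L.qf_eq, hd]
    simp only [u, AddMonoidHom.mk'_apply, Matrix.cons_val_zero, Matrix.cons_val_one,
      Matrix.cons_val]
    push_cast
    field_simp
  · have h0 : (p : ℤ_[p]) ∣ d c := hc 0
    have h1 : (p : ℤ_[p]) ∣ L.u (Y.mulVec c) 1 := hc 1
    have h2 : (p : ℤ_[p]) ∣ L.u (Y.mulVec c) 2 := hc 2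
    obtain ⟨y, hy⟩ := L.prim (Y.mulVec c) fun i => by
      fin_cases i
      · exact ⟨d c, hd c⟩
      · exact h1
      · exact h2
    have h3 : y ∈ colLattice Y := by
      rw [hY, L.mem_half, L.red_apply_eq_zero]
      have := hd c
      rw [hy, L.u_zsmul, Int.cast_natCast] at this
      rwa [mul_left_cancel₀ hp0 this]
    obtain ⟨c', rfl⟩ := mem_colLattice.1 h3
    refine ⟨c', Matrix.mulVec_injective_of_det_ne_zero hYd ?_⟩
    rw [hy, Matrix.mulVec_smul]

lemma rEval_eq_card_mem {N : AddSubgroup (Fin 3 → ℤ)} {Y : IntMat} (hYd : Y.det ≠ 0)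
    (hY : colLattice Y = N) {G : RatMat} (hG : G = (p : ℚ)⁻¹ • ((intMap Y)ᵀ * T * intMap Y))
    (m : ℤ) :
    rEval G (p * m) = Nat.card {x // x ∈ N ∧ qf T x = (p : ℚ) ^ 2 * m} := by
  have hpq : (p : ℚ) ≠ 0 := by exact_mod_cast (Fact.out : p.Prime).ne_zero
  have hq : ∀ c, qf G c = (p * m : ℤ) ↔ qf T (Y.mulVec c) = (p : ℚ) ^ 2 * m := fun c => by
    rw [hG, qf_smul, ← qf_mulVec, inv_mul_eq_iff_eq_mul₀ hpq]
    push_cast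
    rw [← mul_assoc, sq]
  refine Nat.card_congr (Equiv.ofBijective (fun c => ⟨Y.mulVec c.1, ?_, (hq _).1 c.2⟩) ⟨?_, ?_⟩)
  · rw [← hY]; exact mulVec_mem_colLattice _ _
  · intro c c' h
    exact Subtype.ext (Matrix.mulVec_injective_of_det_ne_zero hYd (congrArg Subtype.val h))
  · rintro ⟨x, hx, hxq⟩
    rw [← hY] at hx
    obtain ⟨c, rfl⟩ := mem_colLattice.1 hx
    exact ⟨⟨c, (hq c).2 hxq⟩, rfl⟩

lemma rEval_half_add (hT : PosDef3 T) (L : LocalCoord p T (p * ε)) {Y₁ Y₂ : IntMat}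
    (hd₁ : Y₁.det ≠ 0) (hd₂ : Y₂.det ≠ 0) (hY₁ : colLattice Y₁ = L.half)
    (hY₂ : colLattice Y₂ = L.swap.half) {G₁ G₂ : RatMat}
    (hG₁ : G₁ = (p : ℚ)⁻¹ • ((intMap Y₁)ᵀ * T * intMap Y₁))
    (hG₂ : G₂ = (p : ℚ)⁻¹ • ((intMap Y₂)ᵀ * T * intMap Y₂)) (m : ℤ) :
    (rEval G₁ (p * m) : ℚ) + rEval G₂ (p * m) = rEval T ((p : ℤ) ^ 2 * m) + rEval T m := by
  have hp := (Fact.out : p.Prime)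
  have h := sum_card_mem_eq hp.ne_zero hT (E := (Finset.univ : Finset Bool))
    (M := fun b => if b then L.half else L.swap.half) (m := m) (α := 2) (β := 1) ?_ ?_
  · rw [rEval_eq_card_mem hd₁ hY₁ hG₁, rEval_eq_card_mem hd₂ hY₂ hG₂]
    simp only [Fintype.sum_bool, if_true, Bool.false_eq_true, if_false] at h
    rw [h]
    ring
  · intro x
    have h0 := L.red_eq_zero.2 ⟨x, rfl⟩
    have h1 := L.swap.red_eq_zero.2 ⟨x, rfl⟩
    have : Nat.card {b : Bool // b ∈ (Finset.univ : Finset Bool) ∧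
        (p : ℤ) • x ∈ if b then L.half else L.swap.half} = (Finset.univ : Finset Bool).card :=
      Nat.subtype_card _ fun b => by
        have hm : (p : ℤ) • x ∈ if b then L.half else L.swap.half := by
          cases b
          · exact congrFun h1 0
          · exact congrFun h0 0
        exact ⟨fun h => ⟨h, hm⟩, fun h => h.1⟩
    rw [this]
    simp
  · intro x hx hxp
    rw [← L.red_eq_zero] at hxp
    have h0 := L.qf_mod (x := x) (k := p ^ 2 * m) (by rw [hx]; push_cast; rfl)
    rw [toZMod_p_mul, zero_mul, add_zero] at h0
    have hne : ¬ (L.red x 0 = 0 ∧ L.red x 1 = 0) := fun h =>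
      hxp (L.red_eq_zero_of_sq_dvd hx h.1 h.2)
    have h0' : L.red x 0 * L.red x 1 = 0 := by rw [← h0]; simp
    have : ∃ b₀ : Bool, ∀ b, (x ∈ if b then L.half else L.swap.half) ↔ b = b₀ := by
      rcases mul_eq_zero.1 h0' with h | h
      · refine ⟨true, fun b => ?_⟩
        have h1 : L.red x 1 ≠ 0 := fun h1 => hne ⟨h, h1⟩
        cases b <;> simp [LocalCoord.mem_half, LocalCoord.swap_red_zero, h, h1]
      · refine ⟨false, fun b => ?_⟩
        have h1 : L.red x 0 ≠ 0 := fun h1 => hne ⟨h1, h⟩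
        cases b <;> simp [LocalCoord.mem_half, LocalCoord.swap_red_zero, h, h1]
    obtain ⟨b₀, hb₀⟩ := this
    have : Nat.card {b : Bool // b ∈ (Finset.univ : Finset Bool) ∧
        x ∈ if b then L.half else L.swap.half} = ({b₀} : Finset Bool).card :=
      Nat.subtype_card _ fun b => by simp [hb₀]
    rw [this]
    simp

end HalfLattice

section Conic

variable {p : ℕ} [Fact p.Prime] {e : ZMod p}

/-- Representatives of the isotropic lines of the form `v₀ v₁ + e v₂²` over the prime field. -/
def conicReps (p : ℕ) [Fact p.Prime] (e : ZMod p) : Finset (Fin 3 → ZMod p) :=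
  insert ![0, 1, 0] (Finset.univ.image fun t => ![1, -(e * t ^ 2), t])

lemma mem_conicReps {w : Fin 3 → ZMod p} :
    w ∈ conicReps p e ↔
      (w 0 = 0 ∧ w 1 = 1 ∧ w 2 = 0) ∨ (w 0 = 1 ∧ w 1 = -(e * w 2 ^ 2)) := by
  rw [conicReps, Finset.mem_insert, Finset.mem_image]
  constructor
  · rintro (rfl | ⟨t, -, rfl⟩) <;> simp
  · rintro (⟨h0, h1, h2⟩ | ⟨h0, h1⟩)
    · exact Or.inl (by ext i; fin_cases i <;> simp [h0, h1, h2])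
    · exact Or.inr ⟨w 2, Finset.mem_univ _, by ext i; fin_cases i <;> simp [h0, h1]⟩

lemma card_conicReps : (conicReps p e).card = p + 1 := by
  rw [conicReps, Finset.card_insert_of_notMem, Finset.card_image_of_injective, Finset.card_univ,
    ZMod.card]
  · intro s t h
    simpa using congrFun h 2
  · intro h
    obtain ⟨t, -, ht⟩ := Finset.mem_image.1 h
    simpa using congrFun ht 0

lemma isotropic_of_mem_conicReps {w : Fin 3 → ZMod p} (hw : w ∈ conicReps p e) :
    w 0 * w 1 + e * w 2 ^ 2 = 0 := by
  rcases mem_conicReps.1 hw with ⟨h0, h1, h2⟩ | ⟨h0, h1⟩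
  · simp [h0, h2]
  · rw [h0, h1]; ring

/-- The polar form of `v₀ v₁ + e v₂²`. -/
def conicPolar (e : ZMod p) (v w : Fin 3 → ZMod p) : ZMod p :=
  v 0 * w 1 + w 0 * v 1 + 2 * e * v 2 * w 2

lemma conicPolar_self {v : Fin 3 → ZMod p} (hv : v 0 * v 1 + e * v 2 ^ 2 = 0) :
    conicPolar e v v = 0 := by
  rw [conicPolar]
  linear_combination 2 * hv

lemma conicPolar_comm (v w : Fin 3 → ZMod p) : conicPolar e v w = conicPolar e w v := by
  rw [conicPolar, conicPolar]
  ring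

lemma conicPolar_combination (a b : ZMod p) (v v' w : Fin 3 → ZMod p) :
    conicPolar e (a • v + b • v') w = a * conicPolar e v w + b * conicPolar e v' w := by
  simp only [conicPolar, Pi.add_apply, Pi.smul_apply, smul_eq_mul]
  ring

lemma conicPolar_smul (a : ZMod p) (v w : Fin 3 → ZMod p) :
    conicPolar e (a • v) w = a * conicPolar e v w := by
  simp only [conicPolar, Pi.smul_apply, smul_eq_mul]
  ring

lemma conicPolar_ne_zero (he : e ≠ 0) {w w' : Fin 3 → ZMod p} (hw : w ∈ conicReps p e)
    (hw' : w' ∈ conicReps p e) (hne : w ≠ w') : conicPolar e w w' ≠ 0 := by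
  rcases mem_conicReps.1 hw with ⟨h0, h1, h2⟩ | ⟨h0, h1⟩ <;>
    rcases mem_conicReps.1 hw' with ⟨h0', h1', h2'⟩ | ⟨h0', h1'⟩
  · exact absurd (by ext i; fin_cases i <;> simp [h0, h1, h2, h0', h1', h2']) hne
  · simp [conicPolar, h0, h1, h2, h0']
  · simp [conicPolar, h0, h0', h1', h2']
  · have : conicPolar e w w' = -(e * (w 2 - w' 2) ^ 2) := by
      rw [conicPolar, h0, h1, h0', h1']
      ring
    rw [this, neg_ne_zero]
    refine mul_ne_zero he (pow_ne_zero 2 (sub_ne_zero.2 fun h => hne ?_))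
    ext i
    fin_cases i <;> simp [h0, h1, h0', h1', h]

lemma exists_mem_conicReps (he : e ≠ 0) {v : Fin 3 → ZMod p} (hv : v 0 * v 1 + e * v 2 ^ 2 = 0)
    (hne : v ≠ 0) : ∃ w ∈ conicReps p e, ∃ a : ZMod p, a ≠ 0 ∧ a • w = v := by
  by_cases h0 : v 0 = 0
  · have h2 : v 2 = 0 := by
      rw [h0, zero_mul, zero_add] at hv
      exact eq_zero_of_pow_eq_zero ((mul_eq_zero.1 hv).resolve_left he)
    have h1 : v 1 ≠ 0 := fun h1 => hne (by ext i; fin_cases i <;> simp [h0, h1, h2])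
    refine ⟨(v 1)⁻¹ • v, mem_conicReps.2 (Or.inl ?_), v 1, h1, ?_⟩
    · simp [h0, h1, h2]
    · rw [smul_smul, mul_inv_cancel₀ h1, one_smul]
  · refine ⟨(v 0)⁻¹ • v, mem_conicReps.2 (Or.inr ?_), v 0, h0, ?_⟩
    · simp only [Pi.smul_apply, smul_eq_mul]
      refine ⟨inv_mul_cancel₀ h0, ?_⟩
      field_simp
      linear_combination hv
    · rw [smul_smul, mul_inv_cancel₀ h0, one_smul]

lemma eq_of_mem_span_pair (he : e ≠ 0) {w w₁ w₂ : Fin 3 → ZMod p} (hw : w ∈ conicReps p e)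
    (h₁ : w₁ ∈ conicReps p e) (h₂ : w₂ ∈ conicReps p e)
    (h : w ∈ Submodule.span (ZMod p) {w₁, w₂}) : w = w₁ ∨ w = w₂ := by
  obtain ⟨a, b, rfl⟩ := Submodule.mem_span_pair.1 h
  by_cases h12 : w₁ = w₂
  · subst h12
    by_contra hcon
    refine conicPolar_ne_zero he hw h₁ (fun h => hcon (Or.inl h)) ?_
    rw [conicPolar_combination, conicPolar_self (isotropic_of_mem_conicReps h₁)]
    ring
  by_contra hcon
  push Not at hcon
  have hB := conicPolar_ne_zero he h₁ h₂ h12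
  have h3 := conicPolar_self (isotropic_of_mem_conicReps hw)
  have hb := conicPolar_ne_zero he hw h₁ hcon.1
  have ha := conicPolar_ne_zero he hw h₂ hcon.2
  rw [conicPolar_combination, conicPolar_self (isotropic_of_mem_conicReps h₁),
    conicPolar_comm w₂ w₁] at hb
  rw [conicPolar_combination, conicPolar_self (isotropic_of_mem_conicReps h₂)] at ha
  have hab : a * b * conicPolar e w₁ w₂ = 0 := by
    have h4 := isotropic_of_mem_conicReps hw
    have h5 := isotropic_of_mem_conicReps h₁
    have h6 := isotropic_of_mem_conicReps h₂
    simp only [Pi.add_apply, Pi.smul_apply, smul_eq_mul] at h4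
    rw [conicPolar]
    linear_combination h4 - a ^ 2 * h5 - b ^ 2 * h6
  rcases mul_eq_zero.1 ((mul_eq_zero.1 hab).resolve_right hB) with h | h
  · exact ha (by rw [h]; ring)
  · exact hb (by rw [h]; ring)

lemma finrank_span_conic_pair (he : e ≠ 0) {w₁ w₂ : Fin 3 → ZMod p}
    (h₁ : w₁ ∈ conicReps p e) (h₂ : w₂ ∈ conicReps p e) (hne : w₁ ≠ w₂) :
    Module.finrank (ZMod p) (Submodule.span (ZMod p) {w₁, w₂}) = 2 := by
  have hB := conicPolar_ne_zero he h₁ h₂ hne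
  have hli : LinearIndependent (ZMod p) ![w₁, w₂] := by
    rw [LinearIndependent.pair_iff]
    intro s t h
    have hz : ∀ w, conicPolar e (s • w₁ + t • w₂) w = 0 := fun w => by
      rw [h]
      simp [conicPolar]
    constructor
    · have := hz w₂
      rw [conicPolar_combination, conicPolar_self (isotropic_of_mem_conicReps h₂), mul_zero,
        add_zero] at this
      exact (mul_eq_zero.1 this).resolve_right hB
    · have := hz w₁
      rw [conicPolar_combination, conicPolar_self (isotropic_of_mem_conicReps h₁), mul_zero,
        zero_add, conicPolar_comm] at this
      exact (mul_eq_zero.1 this).resolve_right hB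
  have := finrank_span_eq_card hli
  rw [Matrix.range_cons, Matrix.range_cons, Matrix.range_empty, Set.union_empty,
    Set.singleton_union] at this
  simpa using this

/-- The pairs of isotropic lines. -/
def conicPairs (p : ℕ) [Fact p.Prime] (e : ZMod p) : Finset (Finset (Fin 3 → ZMod p)) :=
  (conicReps p e).powersetCard 2

lemma mem_conicPairs {E : Finset (Fin 3 → ZMod p)} : E ∈ conicPairs p e ↔
    ∃ w₁ ∈ conicReps p e, ∃ w₂ ∈ conicReps p e, w₁ ≠ w₂ ∧ E = {w₁, w₂} := by
  rw [conicPairs, Finset.mem_powersetCard]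
  constructor
  · rintro ⟨hE, hc⟩
    obtain ⟨w₁, w₂, hne, rfl⟩ := Finset.card_eq_two.1 hc
    exact ⟨w₁, hE (by simp), w₂, hE (by simp), hne, rfl⟩
  · rintro ⟨w₁, h₁, w₂, h₂, hne, rfl⟩
    refine ⟨?_, Finset.card_pair hne⟩
    intro w hw
    rcases Finset.mem_insert.1 hw with rfl | h
    · exact h₁
    · rwa [Finset.mem_singleton.1 h]

lemma card_conicPairs : ((conicPairs p e).card : ℚ) = (p + 1) * p / 2 := by
  rw [conicPairs, Finset.card_powersetCard, card_conicReps, Nat.cast_choose_two]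
  push_cast
  ring

lemma mem_span_conicPairs_iff (he : e ≠ 0) {E : Finset (Fin 3 → ZMod p)} (hE : E ∈ conicPairs p e)
    {w : Fin 3 → ZMod p} (hw : w ∈ conicReps p e) :
    w ∈ Submodule.span (ZMod p) (E : Set (Fin 3 → ZMod p)) ↔ w ∈ E := by
  refine ⟨fun h => ?_, fun h => Submodule.subset_span h⟩
  obtain ⟨w₁, h₁, w₂, h₂, -, rfl⟩ := mem_conicPairs.1 hE
  rw [Finset.coe_pair] at h
  have := eq_of_mem_span_pair he hw h₁ h₂ h
  simpa using this

lemma span_conicPairs_injOn (he : e ≠ 0) :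
    Set.InjOn (fun E : Finset (Fin 3 → ZMod p) => Submodule.span (ZMod p) (E : Set (Fin 3 → ZMod p)))
      (conicPairs p e) := by
  intro E hE E' hE' h
  beta_reduce at h
  have hsub : ∀ {E}, E ∈ conicPairs p e → E ⊆ conicReps p e := fun h =>
    (Finset.mem_powersetCard.1 h).1
  ext w
  constructor
  · intro hw
    rw [← mem_span_conicPairs_iff he hE' (hsub hE hw), ← h]
    exact Submodule.subset_span hw
  · intro hw
    rw [← mem_span_conicPairs_iff he hE (hsub hE' hw), h]
    exact Submodule.subset_span hw

lemma natCard_conicPairs_through (he : e ≠ 0) {v : Fin 3 → ZMod p}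
    (hv : v 0 * v 1 + e * v 2 ^ 2 = 0) (hne : v ≠ 0) :
    Nat.card {E // E ∈ conicPairs p e ∧
      v ∈ Submodule.span (ZMod p) (E : Set (Fin 3 → ZMod p))} = p := by
  obtain ⟨w, hw, a, ha, rfl⟩ := exists_mem_conicReps he hv hne
  have hcard : (((conicReps p e).erase w).image fun w' => ({w, w'} : Finset _)).card = p := by
    rw [Finset.card_image_of_injOn, Finset.card_erase_of_mem hw, card_conicReps, Nat.add_sub_cancel]
    intro x hx y hy h
    beta_reduce at h
    have hx' := Finset.mem_erase.1 (Finset.mem_coe.1 hx)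
    have : x ∈ ({w, y} : Finset (Fin 3 → ZMod p)) := by
      rw [← h]
      simp
    simpa [hx'.1] using this
  refine (Nat.subtype_card _ fun E => ?_).trans hcard
  rw [Finset.mem_image]
  constructor
  · rintro ⟨w', hw', rfl⟩
    obtain ⟨h1, h2⟩ := Finset.mem_erase.1 hw'
    exact ⟨mem_conicPairs.2 ⟨w, hw, w', h2, h1.symm, rfl⟩,
      Submodule.smul_mem _ _ (Submodule.subset_span (by simp))⟩
  · rintro ⟨hE, hs⟩
    rw [Submodule.smul_mem_iff _ ha, mem_span_conicPairs_iff he hE hw] at hs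
    obtain ⟨w₁, h₁, w₂, h₂, h12, rfl⟩ := mem_conicPairs.1 hE
    rcases Finset.mem_insert.1 hs with rfl | h
    · exact ⟨w₂, Finset.mem_erase.2 ⟨h12.symm, h₂⟩, rfl⟩
    · obtain rfl := Finset.mem_singleton.1 h
      exact ⟨w₁, Finset.mem_erase.2 ⟨h12, h₁⟩, Finset.pair_comm _ _⟩

lemma LocalCoord.pre_conicPairs_index {A : RatMat} {η : ℤ_[p]} (L : LocalCoord p A η) (he : e ≠ 0)
    {E : Finset (Fin 3 → ZMod p)} (hE : E ∈ conicPairs p e) :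
    (L.pre (Submodule.span (ZMod p) (E : Set (Fin 3 → ZMod p)))).index = p := by
  obtain ⟨w₁, h₁, w₂, h₂, hne, rfl⟩ := mem_conicPairs.1 hE
  rw [Finset.coe_pair]
  have h := L.pre_index (Submodule.span (ZMod p) {w₁, w₂})
  rw [finrank_span_conic_pair he h₁ h₂ hne, pow_succ p 2] at h
  exact Nat.eq_of_mul_eq_mul_left (pow_pos (Fact.out : p.Prime).pos 2) h

end Conic

section Pairs

variable {p : ℕ} [Fact p.Prime] {ε : ℤ_[p]ˣ} {G S : RatMat}

lemma toZMod_unit_ne_zero (ε : ℤ_[p]ˣ) : PadicInt.toZMod (ε : ℤ_[p]) ≠ 0 :=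
  (ε.isUnit.map _).ne_zero

/-- The sublattices of index `p` of type `H ⊕ [p² ε]` of a lattice of type `H ⊕ [ε]` are given by
pairs of isotropic lines. -/
lemma exists_pair_of_isometry (LG : LocalCoord p G (ε : ℤ_[p]))
    (hS : PosDef3 S) (hSh : HalfIntegral S) (LS : LocalCoord p S ((p : ℤ_[p]) ^ 2 * ε))
    {X : IntMat} (hX : (intMap X)ᵀ * G * intMap X = S) (hXd : X.det.natAbs = p) :
    ∃ E ∈ conicPairs p (PadicInt.toZMod (ε : ℤ_[p])),
      colLattice X = LG.pre (Submodule.span (ZMod p) (E : Set (Fin 3 → ZMod p))) := by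
  have hp := (Fact.out : p.Prime)
  have he := toZMod_unit_ne_zero ε
  set e := PadicInt.toZMod (ε : ℤ_[p]) with hedef
  have hXd0 : X.det ≠ 0 := fun h => by
    rw [h] at hXd
    exact hp.ne_zero hXd.symm
  obtain ⟨a, ha⟩ := LS.red_surjective ![1, 0, 0]
  obtain ⟨b, hb⟩ := LS.red_surjective ![0, 1, 0]
  have hiso : ∀ c, LS.red c 0 * LS.red c 1 = 0 → LG.red (X.mulVec c) 0 * LG.red (X.mulVec c) 1 +
      e * LG.red (X.mulVec c) 2 ^ 2 = 0 := by
    intro c hc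
    obtain ⟨k, hk⟩ := hSh.exists_qf hS.1 c
    have h1 := LS.qf_mod hk
    rw [hc, toZMod_p_sq_mul, zero_mul, add_zero] at h1
    rw [← LG.qf_mod (x := X.mulVec c) (k := k) (by rw [qf_mulVec, hX, hk]), h1]
  obtain ⟨l, hl⟩ := hSh.exists_polar3 hS.1 a b
  have h2 := LS.polar_mod hl
  have h3 : (l : ZMod p) = conicPolar e (LG.red (X.mulVec a)) (LG.red (X.mulVec b)) :=
    LG.polar_mod (by rw [polar3_mulVec, hX, hl])
  have h4 : conicPolar e (LG.red (X.mulVec a)) (LG.red (X.mulVec b)) = 1 := by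
    rw [← h3, h2, ha, hb]
    simp
  have hia := hiso a (by simp [ha])
  have hib := hiso b (by simp [hb])
  have hna : LG.red (X.mulVec a) ≠ 0 := fun h => by
    rw [h] at h4
    simp [conicPolar] at h4
  have hnb : LG.red (X.mulVec b) ≠ 0 := fun h => by
    rw [h] at h4
    simp [conicPolar] at h4
  obtain ⟨w₁, hw₁, r, hr, hrw⟩ := exists_mem_conicReps he hia hna
  obtain ⟨w₂, hw₂, s, hs, hsw⟩ := exists_mem_conicReps he hib hnb
  have hne : w₁ ≠ w₂ := by
    rintro rfl
    rw [← hrw, ← hsw, conicPolar_smul, conicPolar_comm, conicPolar_smul,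
      conicPolar_self (isotropic_of_mem_conicReps hw₁)] at h4
    simp at h4
  have hE : ({w₁, w₂} : Finset (Fin 3 → ZMod p)) ∈ conicPairs p e :=
    mem_conicPairs.2 ⟨w₁, hw₁, w₂, hw₂, hne, rfl⟩
  have hidx : (colLattice X).index = p := by rw [colLattice_index hXd0, hXd]
  have hlift : ∀ (c : Fin 3 → ℤ) (w : Fin 3 → ZMod p) (r : ZMod p), r ≠ 0 →
      r • w = LG.red (X.mulVec c) → ∃ x ∈ colLattice X, LG.red x = w := by
    intro c w r hr h
    refine ⟨(r⁻¹).val • X.mulVec c, nsmul_mem (mulVec_mem_colLattice X c) _, ?_⟩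
    rw [map_nsmul, ← h, ← Nat.cast_smul_eq_nsmul (ZMod p), ZMod.natCast_zmod_val, smul_smul,
      inv_mul_cancel₀ hr, one_smul]
  refine ⟨_, hE, (addSubgroup_eq_of_le_of_index_eq ?_ ?_ ?_).symm⟩
  · refine LG.pre_span_le (fun y => ?_) fun v hv => ?_
    · have := AddSubgroup.nsmul_index_mem (H := colLattice X) y
      rw [hidx] at this
      rwa [natCast_zsmul]
    · rcases Finset.mem_insert.1 (Finset.mem_coe.1 hv) with rfl | h
      · exact hlift a _ r hr hrw
      · obtain rfl := Finset.mem_singleton.1 h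
        exact hlift b _ s hs hsw
  · rw [LG.pre_conicPairs_index he hE]
    exact hp.ne_zero
  · rw [LG.pre_conicPairs_index he hE, hidx]

lemma exists_basis_of_pair {T : RatMat} (hT : PosDef3 T)
    (hTp : ZpEquivTo p T (Hblock p ((p : ℚ_[p]) * ((ε : ℤ_[p]) : ℚ_[p]))))
    {Y : IntMat} (hYd : Y.det.natAbs = p) (hG : G = (p : ℚ)⁻¹ • ((intMap Y)ᵀ * T * intMap Y))
    (hGP : PosDef3 G) (hGh : HalfIntegral G) (LG : LocalCoord p G (ε : ℤ_[p]))
    {E : Finset (Fin 3 → ZMod p)} (hE : E ∈ conicPairs p (PadicInt.toZMod (ε : ℤ_[p]))) :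
    ∃ X : IntMat, colLattice X = LG.pre (Submodule.span (ZMod p) (E : Set (Fin 3 → ZMod p))) ∧
      HalfIntegral ((intMap X)ᵀ * G * intMap X) ∧ PosDef3 ((intMap X)ᵀ * G * intMap X) ∧
      ZpEquivTo p ((intMap X)ᵀ * G * intMap X)
        (Hblock p ((p : ℚ_[p]) ^ 2 * ((ε : ℤ_[p]) : ℚ_[p]))) ∧
      ∀ q : ℕ, ∀ hq : q.Prime, q ≠ p →
        @ZqEquiv q ⟨hq⟩ ((intMap X)ᵀ * G * intMap X) ((p : ℚ) • T) := by
  have hp := (Fact.out : p.Prime)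
  have he := toZMod_unit_ne_zero ε
  have hidx := LG.pre_conicPairs_index he hE
  obtain ⟨X, hX, hXd⟩ := exists_colLattice_eq (hidx ▸ hp.ne_zero)
  rw [hidx] at hXd
  have hXh : HalfIntegral ((intMap X)ᵀ * G * intMap X) := by
    rw [halfIntegral_iff (isSymm_transpose_mul_mul hGP.1 _)]
    intro c
    obtain ⟨k, hk⟩ := hGh.exists_qf hGP.1 (X.mulVec c)
    exact ⟨k, by rw [← qf_mulVec, hk]⟩
  obtain ⟨w₁, h₁, w₂, h₂, hne, rfl⟩ := mem_conicPairs.1 hE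
  have hmem : ∀ w ∈ ({w₁, w₂} : Finset (Fin 3 → ZMod p)), ∃ c, LG.red (X.mulVec c) = w := by
    intro w hw
    obtain ⟨x, hx⟩ := LG.red_surjective w
    have hxX : x ∈ colLattice X := by
      rw [hX, LG.mem_pre, hx]
      exact Submodule.subset_span hw
    obtain ⟨c, rfl⟩ := mem_colLattice.1 hxX
    exact ⟨c, hx⟩
  obtain ⟨b, hb⟩ := hmem w₁ (by simp)
  obtain ⟨a, ha⟩ := hmem w₂ (by simp)
  obtain ⟨k, hk⟩ := hGh.exists_qf hGP.1 (X.mulVec b)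
  have h1 := LG.qf_mod hk
  rw [hb, isotropic_of_mem_conicReps h₁, intCast_zmod_eq_zero_iff] at h1
  obtain ⟨k', rfl⟩ := h1
  obtain ⟨l, hl⟩ := hGh.exists_polar3 hGP.1 (X.mulVec b) (X.mulVec a)
  have h3 : (l : ZMod p) = conicPolar _ (LG.red (X.mulVec b)) (LG.red (X.mulVec a)) :=
    LG.polar_mod hl
  obtain ⟨g1, g2, g3⟩ := genus_of_sublattice hT hTp (W := Y * X)
    (by rw [Matrix.det_mul, Int.natAbs_mul, hYd, hXd, sq])
    (A := (intMap X)ᵀ * G * intMap X)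
    (by rw [intMap_transform_mul, hG, Matrix.mul_smul, Matrix.smul_mul])
    hXh (b := b) (a := a) (k := k') (l := l)
    (by rw [← qf_mulVec, hk]; push_cast; rfl) (by rw [← polar3_mulVec, hl])
    (by
      rw [← intCast_zmod_eq_zero_iff, h3, ha, hb]
      exact conicPolar_ne_zero he h₁ h₂ hne)
  exact ⟨X, hX, hXh, g1, g2, g3⟩

end Pairs

/-- The weighted sum over the genus `H ⊕ [p² ε]` of the numbers of embeddings into a lattice of
type `H ⊕ [ε]`, evaluated by counting pairs of isotropic lines modulo `p`. -/
lemma sum_isometries {p : ℕ} [Fact p.Prime] {ε : ℤ_[p]ˣ} {T : RatMat} (hT : PosDef3 T)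
    (hTp : ZpEquivTo p T (Hblock p ((p : ℚ_[p]) * ((ε : ℤ_[p]) : ℚ_[p]))))
    {g : ℕ} {St : Fin g → RatMat} (hSt : ∀ i, PosDef3 (St i) ∧ HalfIntegral (St i))
    (hStne : ∀ i j, i ≠ j → ¬ ZEquiv (St i) (St j))
    (hStp : ∀ i, ZpEquivTo p (St i) (Hblock p ((p : ℚ_[p]) ^ 2 * ((ε : ℤ_[p]) : ℚ_[p]))))
    (hStcomp : ∀ A : RatMat, PosDef3 A → HalfIntegral A →
      ZpEquivTo p A (Hblock p ((p : ℚ_[p]) ^ 2 * ((ε : ℤ_[p]) : ℚ_[p]))) →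
      (∀ q : ℕ, ∀ hq : q.Prime, q ≠ p → @ZqEquiv q ⟨hq⟩ A ((p : ℚ) • T)) →
      ∃ i, ZEquiv A (St i))
    {Y : IntMat} (hYd : Y.det.natAbs = p) {G : RatMat}
    (hG : G = (p : ℚ)⁻¹ • ((intMap Y)ᵀ * T * intMap Y))
    (hGP : PosDef3 G) (hGh : HalfIntegral G) (LG : LocalCoord p G (ε : ℤ_[p]))
    (hdet : ∀ i, |(St i).det| = p ^ 2 * |G.det|) (m : ℤ) :
    ∑ i, (Nat.card {X : IntMat // (intMap X)ᵀ * G * intMap X = St i} : ℚ) / autNum (St i) *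
        rEval (St i) ((p : ℤ) ^ 2 * m) =
      p * rEval G ((p : ℤ) ^ 2 * m) + ((p + 1) * p / 2 - p) * rEval G m := by
  have hp := (Fact.out : p.Prime)
  have he := toZMod_unit_ne_zero ε
  set e := PadicInt.toZMod (ε : ℤ_[p]) with hedef
  have h1 := sum_orbits (fun i => (hSt i).1) hStne (B := G) (c := 1) one_ne_zero
    (E := conicPairs p e)
    (M := fun E => LG.pre (Submodule.span (ZMod p) (E : Set (Fin 3 → ZMod p))))
    (R := fun i => {X | (intMap X)ᵀ * G * intMap X = St i}) ?_ ?_ ?_ ((p : ℤ) ^ 2 * m)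
  · refine h1.trans ?_
    rw [← sum_card_mem_eq hp.ne_zero hGP (E := conicPairs p e)
      (M := fun E => LG.pre (Submodule.span (ZMod p) (E : Set (Fin 3 → ZMod p)))) (m := m)]
    · push_cast
      simp only [one_mul]
    · intro x
      rw [← card_conicPairs (e := e)]
      congr 1
      exact Nat.subtype_card _ fun E => ⟨fun h => ⟨h, LG.smul_mem_pre _ x⟩, fun h => h.1⟩
    · intro x hx hxp
      rw [← LG.red_eq_zero] at hxp
      have h0 := LG.qf_mod (x := x) (k := p ^ 2 * m) (by rw [hx]; push_cast; rfl)
      have := natCard_conicPairs_through he (v := LG.red x) (by rw [← h0]; simp) hxp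
      exact_mod_cast this
  · exact LG.pre_injective.comp_injOn (span_conicPairs_injOn he)
  · intro i X
    rw [Set.mem_ofPred_eq, one_smul]
    refine ⟨fun hX => ⟨hX, ?_⟩, And.left⟩
    have hXd : X.det.natAbs = p := by
      have := natAbs_det_of_isometry (p := p) (k := 1) hGP.det_ne_zero (c := 1) (S := St i)
        (by rw [hdet]; ring) zero_le_one (X := X) (by rw [hX, one_smul])
      rwa [pow_one] at this
    obtain ⟨LS⟩ := exists_localCoord_of_zpEquivTo (A := St i) (η := (p : ℤ_[p]) ^ 2 * (ε : ℤ_[p]))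
      (by simpa using hStp i)
    exact exists_pair_of_isometry LG (hSt i).1 (hSt i).2 LS hX hXd
  · intro E hE
    obtain ⟨X, hX, hAh, hA, hAp, hAq⟩ := exists_basis_of_pair hT hTp hYd hG hGP hGh LG hE
    obtain ⟨i, V, hV, hVA⟩ := hStcomp _ hA hAh hAp hAq
    refine ⟨i, X * V, ?_, by rw [colLattice_mul_unimodular _ hV, hX]⟩
    rw [intMap_transform_mul, hVA, one_smul]

section Transform

lemma transform_unimodular {C : IntMat} (hC : IsUnit C.det) (A : RatMat) :
    (intMap C⁻¹)ᵀ * ((intMap C)ᵀ * A * intMap C) * intMap C⁻¹ = A := by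
  rw [← intMap_transform_mul, Matrix.mul_nonsing_inv C hC, intMap_one]
  simp

lemma ZEquiv.symm {A B : RatMat} (h : ZEquiv A B) : ZEquiv B A := by
  obtain ⟨C, hC, rfl⟩ := h
  exact ⟨C⁻¹, Matrix.isUnit_nonsing_inv_det C hC, transform_unimodular hC A⟩

lemma ZEquiv.trans {A B D : RatMat} (h : ZEquiv A B) (h' : ZEquiv B D) : ZEquiv A D := by
  obtain ⟨X, hX, rfl⟩ := h
  obtain ⟨Y, hY, rfl⟩ := h'
  exact ⟨X * Y, by rw [Matrix.det_mul]; exact hX.mul hY, intMap_transform_mul A X Y⟩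

lemma natCard_isometries (A B : RatMat) [Decidable (ZEquiv A B)] :
    Nat.card {Φ : IntMat // IsUnit Φ.det ∧ (intMap Φ)ᵀ * B * intMap Φ = A} =
      if ZEquiv A B then autNum B else 0 := by
  split_ifs with h
  · obtain ⟨C, hC, hCA⟩ := h.symm
    refine Nat.card_congr
      { toFun := fun Φ => ⟨Φ.1 * C⁻¹, ?_, ?_⟩
        invFun := fun Φ => ⟨Φ.1 * C, ?_, ?_⟩
        left_inv := fun Φ => ?_
        right_inv := fun Φ => ?_ }
    · rw [Matrix.det_mul]
      exact Φ.2.1.mul (Matrix.isUnit_nonsing_inv_det C hC)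
    · rw [intMap_transform_mul, Φ.2.2, ← hCA, transform_unimodular hC]
    · rw [Matrix.det_mul]
      exact Φ.2.1.mul hC
    · rw [intMap_transform_mul, Φ.2.2, hCA]
    · exact Subtype.ext (Matrix.nonsing_inv_mul_cancel_right C _ hC)
    · exact Subtype.ext (Matrix.mul_nonsing_inv_cancel_right C _ hC)
  · have : IsEmpty {Φ : IntMat // IsUnit Φ.det ∧ (intMap Φ)ᵀ * B * intMap Φ = A} :=
      ⟨fun Φ => h (ZEquiv.symm ⟨Φ.1, Φ.2⟩)⟩
    exact Nat.card_of_isEmpty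

lemma transform_of_mul_eq_smul_one {p : ℕ} {A : RatMat} {X U : IntMat}
    (h : X * U = (p : ℤ) • (1 : IntMat)) :
    (intMap U)ᵀ * ((intMap X)ᵀ * A * intMap X) * intMap U = (p : ℚ) ^ 2 • A := by
  have h1 : intMap ((p : ℤ) • (1 : IntMat)) = (p : ℚ) • (1 : RatMat) := by
    ext i j
    change (((p : ℤ) • (1 : IntMat) i j : ℤ) : ℚ) = (p : ℚ) • (1 : RatMat) i j
    rw [Matrix.one_apply, Matrix.one_apply]
    split_ifs <;> simp
  rw [← intMap_transform_mul, h, h1, Matrix.transpose_smul, Matrix.transpose_one, Matrix.smul_mul,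
    Matrix.one_mul, Matrix.smul_mul, Matrix.mul_smul, Matrix.mul_one, smul_smul, sq]

lemma lamEq_iff {p : ℕ} {S G : RatMat} {Z : IntMat} (hZ : ∀ x, x ∈ LamSet p S ↔ x ∈ colLattice Z) (hZd : Z.det ≠ 0) :
    lamEq p S G ↔ ZEquiv (((p : ℚ) ^ 2)⁻¹ • ((intMap Z)ᵀ * S * intMap Z)) G := by
  constructor
  · exact fun h => h Z fun x => by rw [hZ, mem_colLattice]
  · intro h Z' hZ'
    have hZZ : colLattice Z = colLattice Z' := by
      ext x
      rw [← hZ, hZ', mem_colLattice]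
    obtain ⟨C, hC, rfl⟩ := exists_unimodular_of_colLattice_eq hZd hZZ
    refine ZEquiv.trans (ZEquiv.symm ⟨C, hC, ?_⟩) h
    rw [intMap_transform_mul, Matrix.mul_smul, Matrix.smul_mul]

end Transform

section Watson

variable {p : ℕ} [Fact p.Prime] {ε : ℤ_[p]ˣ} {G S : RatMat}

lemma mem_lamSet_iff (hS : PosDef3 S) (hSh : HalfIntegral S)
    (LS : LocalCoord p S ((p : ℤ_[p]) ^ 2 * ε)) {x : Fin 3 → ℤ} :
    x ∈ LamSet p S ↔ LS.red x 0 = 0 ∧ LS.red x 1 = 0 := by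
  have hsub : ∀ z, qf S (x + z) - qf S z = qf S x + polar3 S x z := fun z => by
    rw [polar3]; ring
  have hpol : ∀ {z} {l : ℤ}, polar3 S x z = l →
      (l : ZMod p) = LS.red x 0 * LS.red z 1 + LS.red z 0 * LS.red x 1 := fun h => by
    have := LS.polar_mod h
    rwa [toZMod_p_sq_mul, mul_zero, zero_mul, zero_mul, add_zero] at this
  obtain ⟨a, ha⟩ := hSh.exists_qf hS.1 x
  have hqa := LS.qf_mod ha
  rw [toZMod_p_sq_mul, zero_mul, add_zero] at hqa
  constructor
  · intro h
    have hpa : (a : ZMod p) = 0 := by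
      obtain ⟨k, hk⟩ := h 0
      rw [add_zero, qf_eq_zero_of_zero, sub_zero, ha] at hk
      rw [intCast_zmod_eq_zero_iff]
      exact ⟨k, by exact_mod_cast hk⟩
    have key : ∀ z, LS.red x 0 * LS.red z 1 + LS.red z 0 * LS.red x 1 = 0 := fun z => by
      obtain ⟨k, hk⟩ := h z
      obtain ⟨l, hl⟩ := hSh.exists_polar3 hS.1 x z
      rw [hsub, ha, hl] at hk
      have h1 : a + l = p * k := by exact_mod_cast hk
      have h2 := congrArg (Int.cast : ℤ → ZMod p) h1
      push_cast at h2
      rw [← hpol hl]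
      simpa [hpa] using h2
    obtain ⟨y, hy⟩ := LS.red_surjective ![0, 1, 0]
    obtain ⟨z, hz⟩ := LS.red_surjective ![1, 0, 0]
    exact ⟨by simpa [hy] using key y, by simpa [hz] using key z⟩
  · rintro ⟨h0, h1⟩ z
    obtain ⟨l, hl⟩ := hSh.exists_polar3 hS.1 x z
    have h2 := hpol hl
    rw [h0, h1, zero_mul, mul_zero, add_zero, intCast_zmod_eq_zero_iff] at h2
    rw [h0, zero_mul, intCast_zmod_eq_zero_iff] at hqa
    obtain ⟨a', rfl⟩ := hqa
    obtain ⟨l', rfl⟩ := h2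
    exact ⟨a' + l', by rw [hsub, ha, hl]; push_cast; ring⟩

/-- A basis of the Watson sublattice. -/
lemma exists_basis_lamSet (hS : PosDef3 S) (hSh : HalfIntegral S)
    (LS : LocalCoord p S ((p : ℤ_[p]) ^ 2 * ε)) :
    ∃ Z : IntMat, (∀ x, x ∈ LamSet p S ↔ x ∈ colLattice Z) ∧ Z.det.natAbs = p ^ 2 := by
  have hidx := LS.pre_line_index (w := ![0, 0, 1]) fun h => by simpa using congrFun h 2
  obtain ⟨Z, hZ, hZd⟩ := exists_colLattice_eq
    (hidx ▸ pow_ne_zero 2 (Fact.out : p.Prime).ne_zero)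
  refine ⟨Z, fun x => ?_, hZd.trans hidx⟩
  rw [hZ, mem_lamSet_iff hS hSh LS, LS.mem_pre, Submodule.mem_span_singleton]
  constructor
  · rintro ⟨h0, h1⟩
    exact ⟨LS.red x 2, by ext i; fin_cases i <;> simp [h0, h1]⟩
  · rintro ⟨a, ha⟩
    rw [← ha]
    simp

/-- The isometric embeddings of `S` into `G` are counted by the automorphisms of `G`, if `G` is
the Watson transform of `S`, and there are none otherwise. -/
lemma natCard_embeddings (hS : PosDef3 S) (hSh : HalfIntegral S) (hG : PosDef3 G)
    (hGh : HalfIntegral G) (LS : LocalCoord p S ((p : ℤ_[p]) ^ 2 * ε))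
    (hdet : |S.det| = p ^ 2 * |G.det|) [Decidable (lamEq p S G)] :
    Nat.card {X : IntMat // (intMap X)ᵀ * G * intMap X = S} =
      if lamEq p S G then autNum G else 0 := by
  classical
  have hp := (Fact.out : p.Prime)
  have hpq : (p : ℚ) ≠ 0 := by exact_mod_cast hp.ne_zero
  have hpz : (p : ℤ) ≠ 0 := by exact_mod_cast hp.ne_zero
  obtain ⟨Z, hZ, hZd⟩ := exists_basis_lamSet hS hSh LS
  have hZd0 : Z.det ≠ 0 := fun h => by
    rw [h] at hZd
    exact pow_ne_zero 2 hp.ne_zero hZd.symm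
  have hpZ : ∀ y : Fin 3 → ℤ, (p : ℤ) • y ∈ colLattice Z := fun y => by
    rw [← hZ, mem_lamSet_iff hS hSh LS, LS.red_eq_zero.2 ⟨y, rfl⟩]
    exact ⟨rfl, rfl⟩
  obtain ⟨U, hZU, hUZ⟩ := (exists_mul_eq_smul_one_iff hZd0).2 hpZ
  set lam := ((p : ℚ) ^ 2)⁻¹ • ((intMap Z)ᵀ * S * intMap Z) with hlam
  have hif : (if lamEq p S G then autNum G else 0) = if ZEquiv lam G then autNum G else 0 :=
    if_congr (lamEq_iff hZ hZd0) rfl rfl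
  rw [hif, ← natCard_isometries]
  refine (Nat.card_congr (Equiv.ofBijective (fun Φ : {Φ : IntMat // IsUnit Φ.det ∧
    (intMap Φ)ᵀ * G * intMap Φ = lam} => (⟨Φ.1 * U, ?_⟩ :
      {X : IntMat // (intMap X)ᵀ * G * intMap X = S})) ⟨?_, ?_⟩)).symm
  · rw [intMap_transform_mul, Φ.2.2, hlam, Matrix.mul_smul, Matrix.smul_mul,
      transform_of_mul_eq_smul_one hZU, smul_smul, inv_mul_cancel₀ (pow_ne_zero 2 hpq), one_smul]
  · intro Φ Φ' h
    have h1 := congrArg (fun X => X.1 * Z) h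
    simp only [Matrix.mul_assoc, hUZ, Matrix.mul_smul, Matrix.mul_one] at h1
    exact Subtype.ext (smul_right_injective _ hpz h1)
  · rintro ⟨X, hX⟩
    have hXd : X.det.natAbs = p := by
      have := natAbs_det_of_isometry (p := p) (k := 1) hG.det_ne_zero (c := 1) (S := S)
        (by rw [hdet]; ring) zero_le_one (X := X) (by rw [hX, one_smul])
      rwa [pow_one] at this
    have hXd0 : X.det ≠ 0 := fun h => by
      rw [h] at hXd
      exact hp.ne_zero hXd.symm
    obtain ⟨V, hXV, hVX⟩ := (exists_mul_eq_smul_one_iff (p := p) hXd0).2 fun y => by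
      have := AddSubgroup.nsmul_index_mem (H := colLattice X) y
      rwa [colLattice_index hXd0, hXd, ← natCast_zsmul] at this
    have hVZ : ∀ c, V.mulVec c ∈ colLattice Z := fun c => by
      rw [← hZ]
      intro z
      obtain ⟨a, ha⟩ := hGh.exists_qf hG.1 c
      obtain ⟨b, hb⟩ := hGh.exists_polar3 hG.1 c (X.mulVec z)
      have h1 : X.mulVec (V.mulVec c + z) = (p : ℤ) • c + X.mulVec z := by
        rw [Matrix.mulVec_add, Matrix.mulVec_mulVec, hXV, Matrix.smul_mulVec, Matrix.one_mulVec]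
      have h2 : ∀ x, qf S x = qf G (X.mulVec x) := fun x => by rw [qf_mulVec, hX]
      have h3 := polar3_zsmul_left hG.1 p c (X.mulVec z)
      rw [polar3, qf_zsmul, ha, hb] at h3
      refine ⟨p * a + b, ?_⟩
      rw [h2, h2, h1]
      push_cast at h3 ⊢
      linear_combination h3
    obtain ⟨C, rfl⟩ := exists_mul_of_forall_mulVec_mem hVZ
    have hC : IsUnit C.det := by
      have h1 := congrArg (fun M => (Matrix.det M).natAbs) hXV
      simp only [Matrix.det_mul, Int.natAbs_mul, hXd, hZd, Matrix.det_smul, Matrix.det_one,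
        Fintype.card_fin, mul_one, Int.natAbs_pow, Int.natAbs_natCast] at h1
      rw [Int.isUnit_iff_natAbs_eq]
      have h2 : p ^ 3 * C.det.natAbs = p ^ 3 * 1 := by
        rw [mul_one]
        refine Eq.trans ?_ h1
        ring
      exact Nat.eq_of_mul_eq_mul_left (pow_pos hp.pos 3) h2
    have hCX : C * X = U := mul_left_cancel_of_det_ne_zero hZd0 (by
      rw [← Matrix.mul_assoc, hVX, hZU])
    have hCl : (intMap C)ᵀ * lam * intMap C = G := by
      rw [hlam, Matrix.mul_smul, Matrix.smul_mul, ← intMap_transform_mul, ← hX,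
        transform_of_mul_eq_smul_one hXV, smul_smul, inv_mul_cancel₀ (pow_ne_zero 2 hpq), one_smul]
    refine ⟨⟨C⁻¹, Matrix.isUnit_nonsing_inv_det C hC, ?_⟩, Subtype.ext ?_⟩
    · rw [← hCl, transform_unimodular hC]
    · change C⁻¹ * U = X
      rw [← hCX, Matrix.nonsing_inv_mul_cancel_left C _ hC]

end Watson

lemma natAbs_det_eq_index {N : AddSubgroup (Fin 3 → ℤ)} (hN : N.index ≠ 0) {Y : IntMat}
    (hY : colLattice Y = N) : Y.det.natAbs = N.index := by
  obtain ⟨X, hX, hXd⟩ := exists_colLattice_eq hN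
  have hX0 : X.det ≠ 0 := fun h => by
    rw [h] at hXd
    exact hN hXd.symm
  obtain ⟨C, hC, rfl⟩ := exists_unimodular_of_colLattice_eq hX0 (hX.trans hY.symm)
  rw [Matrix.det_mul, Int.natAbs_mul, Int.isUnit_iff_natAbs_eq.1 hC, mul_one, hXd]

open scoped Classical in
/-- The weighted sum of representation numbers over the classes whose Watson transform is a given
sublattice of index `p`. -/
lemma sum_lamEq {p : ℕ} [Fact p.Prime] {ε : ℤ_[p]ˣ} {T : RatMat} (hT : PosDef3 T)
    (hTh : HalfIntegral T)
    (hTp : ZpEquivTo p T (Hblock p ((p : ℚ_[p]) * ((ε : ℤ_[p]) : ℚ_[p]))))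
    {g : ℕ} {St : Fin g → RatMat} (hSt : ∀ i, PosDef3 (St i) ∧ HalfIntegral (St i))
    (hStne : ∀ i j, i ≠ j → ¬ ZEquiv (St i) (St j))
    (hStp : ∀ i, ZpEquivTo p (St i) (Hblock p ((p : ℚ_[p]) ^ 2 * ((ε : ℤ_[p]) : ℚ_[p]))))
    (hStdet : ∀ i, |(St i).det| = |p * T.det|)
    (hStcomp : ∀ A : RatMat, PosDef3 A → HalfIntegral A →
      ZpEquivTo p A (Hblock p ((p : ℚ_[p]) ^ 2 * ((ε : ℤ_[p]) : ℚ_[p]))) →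
      (∀ q : ℕ, ∀ hq : q.Prime, q ≠ p → @ZqEquiv q ⟨hq⟩ A ((p : ℚ) • T)) →
      ∃ i, ZEquiv A (St i))
    (L : LocalCoord p T (p * ε)) {Y : IntMat} (hY : colLattice Y = L.half) {G : RatMat}
    (hG : G = (p : ℚ)⁻¹ • ((intMap Y)ᵀ * T * intMap Y)) (m : ℤ) :
    (autNum G : ℚ) * ∑ i, (if lamEq p (St i) G then
        (rEval (St i) ((p : ℤ) ^ 2 * m) : ℚ) / (autNum (St i) : ℚ) else 0) =
      p * rEval G ((p : ℤ) ^ 2 * m) + ((p + 1) * p / 2 - p) * rEval G m := by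
  have hp := (Fact.out : p.Prime)
  have hpq : (p : ℚ) ≠ 0 := by exact_mod_cast hp.ne_zero
  have hYd : Y.det.natAbs = p :=
    (natAbs_det_eq_index (by rw [L.half_index]; exact hp.ne_zero) hY).trans L.half_index
  have hYd0 : Y.det ≠ 0 := fun h => by
    rw [h] at hYd
    exact hp.ne_zero hYd.symm
  obtain ⟨LG⟩ := exists_localCoord_of_half L hYd0 hY
  rw [← hG] at LG
  have hGP : PosDef3 G := hG ▸ hT.transform hYd0 (inv_pos.2 (by exact_mod_cast hp.pos))
  have hGh : HalfIntegral G := by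
    rw [halfIntegral_iff hGP.1]
    intro c
    obtain ⟨k, hk⟩ := L.exists_qf_of_mem_half hT hTh (hY ▸ mulVec_mem_colLattice Y c)
    exact ⟨k, by rw [hG, qf_smul, ← qf_mulVec, hk, inv_mul_cancel_left₀ hpq]⟩
  have hYq : (Y.det : ℚ) ^ 2 = (p : ℚ) ^ 2 := by
    have : Y.det ^ 2 = (p : ℤ) ^ 2 := by rw [← Int.natAbs_sq, hYd]
    exact_mod_cast this
  have hdet : ∀ i, |(St i).det| = p ^ 2 * |G.det| := fun i => by
    rw [hStdet, hG, Matrix.det_smul, det_transform, hYq, abs_mul, abs_mul, abs_mul, Fintype.card_fin,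
      abs_of_pos (show (0 : ℚ) < (p : ℚ)⁻¹ ^ 3 by have := hp.pos; positivity), abs_sq, Nat.abs_cast]
    field_simp
  rw [← sum_isometries hT hTp hSt hStne hStp hStcomp hYd hG hGP hGh LG hdet m, Finset.mul_sum]
  refine Finset.sum_congr rfl fun i _ => ?_
  obtain ⟨LS⟩ := exists_localCoord_of_zpEquivTo (A := St i) (η := (p : ℤ_[p]) ^ 2 * (ε : ℤ_[p]))
    (by simpa using hStp i)
  rw [natCard_embeddings (hSt i).1 (hSt i).2 hGP hGh LS (hdet i)]
  split_ifs
  · ring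
  · simp

open scoped Classical in
/-- Theorem 4.5 of the paper: for `T ∈ 𝒢_{L,p}(1)` and the complete set `S̃₁,…,S̃_g` of class
representatives of `𝒢_{L,p}(2)`, with `Γ₁, Γ₂` the two index-`p` sublattices of `T` of norm
`pℤ`, we have
`(3p²−p) r(n,T) = ∑ᵢ (r̃(S̃ᵢ^p,T)/o(S̃ᵢ))((3p/2) r(pn,S̃ᵢ) − (p/(p−1)) r(p³n,S̃ᵢ))
 + (1/(p−1))(o(Γ₁) ∑_{λ_p(S̃ᵢ)≅Γ₁} r(p³n,S̃ᵢ)/o(S̃ᵢ) + o(Γ₂) ∑_{λ_p(S̃ᵢ)≅Γ₂} r(p³n,S̃ᵢ)/o(S̃ᵢ))`. -/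
theorem stmt_17 (p : ℕ) [Fact p.Prime] (ε : ℤ_[p]ˣ)
    (T : Matrix (Fin 3) (Fin 3) ℚ) (hT : PosDef3 T) (hTh : HalfIntegral T)
    (hTp : ZpEquivTo p T (Hblock p ((p : ℚ_[p]) * ((ε : ℤ_[p]) : ℚ_[p]))))
    (Γ₁ Γ₂ : AddSubgroup (Fin 3 → ℤ)) (hΓne : Γ₁ ≠ Γ₂)
    (hΓ₁ : Γ₁.index = p ∧ ∀ x ∈ Γ₁, ∃ k : ℤ, qf T x = (p : ℚ) * k)
    (hΓ₂ : Γ₂.index = p ∧ ∀ x ∈ Γ₂, ∃ k : ℤ, qf T x = (p : ℚ) * k)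
    (hΓonly : ∀ N : AddSubgroup (Fin 3 → ℤ),
      (N.index = p ∧ ∀ x ∈ N, ∃ k : ℤ, qf T x = (p : ℚ) * k) → N = Γ₁ ∨ N = Γ₂)
    (Y₁ Y₂ : Matrix (Fin 3) (Fin 3) ℤ)
    (hY₁ : ∀ x, x ∈ Γ₁ ↔ ∃ c, x = Y₁.mulVec c)
    (hY₂ : ∀ x, x ∈ Γ₂ ↔ ∃ c, x = Y₂.mulVec c)
    (G₁ G₂ : Matrix (Fin 3) (Fin 3) ℚ)
    (hG₁ : G₁ = ((p : ℚ))⁻¹ • ((intMap Y₁)ᵀ * T * intMap Y₁))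
    (hG₂ : G₂ = ((p : ℚ))⁻¹ • ((intMap Y₂)ᵀ * T * intMap Y₂))
    (g : ℕ) (St : Fin g → Matrix (Fin 3) (Fin 3) ℚ)
    (hSt : ∀ i, PosDef3 (St i) ∧ HalfIntegral (St i))
    (hStne : ∀ i j, i ≠ j → ¬ ZEquiv (St i) (St j))
    (hStp : ∀ i, ZpEquivTo p (St i) (Hblock p ((p : ℚ_[p]) ^ 2 * ((ε : ℤ_[p]) : ℚ_[p]))))
    (hStloc : ∀ i, ∀ q : ℕ, ∀ hq : q.Prime, q ≠ p → @ZqEquiv q ⟨hq⟩ (St i) ((p : ℚ) • T))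
    (hStcomp : ∀ A : Matrix (Fin 3) (Fin 3) ℚ, PosDef3 A → HalfIntegral A →
      ZpEquivTo p A (Hblock p ((p : ℚ_[p]) ^ 2 * ((ε : ℤ_[p]) : ℚ_[p]))) →
      (∀ q : ℕ, ∀ hq : q.Prime, q ≠ p → @ZqEquiv q ⟨hq⟩ A ((p : ℚ) • T)) →
      ∃ i, ZEquiv A (St i)) :
    ∀ n : ℤ, 0 < n →
      (3 * (p : ℚ) ^ 2 - p) * (rEval T n : ℚ)
        = (∑ i, ((rtilde p (St i) T : ℚ) / (autNum (St i) : ℚ))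
            * ((3 * (p : ℚ) / 2) * (rEval (St i) ((p : ℤ) * n) : ℚ)
              - ((p : ℚ) / ((p : ℚ) - 1)) * (rEval (St i) ((p : ℤ) ^ 3 * n) : ℚ)))
          + (1 / ((p : ℚ) - 1)) *
            ((autNum G₁ : ℚ) * (∑ i, if lamEq p (St i) G₁ then
                (rEval (St i) ((p : ℤ) ^ 3 * n) : ℚ) / (autNum (St i) : ℚ) else 0)
             + (autNum G₂ : ℚ) * (∑ i, if lamEq p (St i) G₂ then
                (rEval (St i) ((p : ℤ) ^ 3 * n) : ℚ) / (autNum (St i) : ℚ) else 0)) := by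
  have hp := (Fact.out : p.Prime)
  obtain ⟨L₀⟩ := exists_localCoord_of_zpEquivTo (A := T) (η := (p : ℤ_[p]) * (ε : ℤ_[p]))
    (by simpa using hTp)
  obtain ⟨L, h₁, h₂⟩ := exists_localCoord_half hT hTh L₀ hΓonly
  have hc₁ : colLattice Y₁ = L.half := by
    ext x
    rw [← h₁, hY₁, mem_colLattice]
  have hc₂ : colLattice Y₂ = L.swap.half := by
    ext x
    rw [← h₂, hY₂, mem_colLattice]
  have hd : ∀ {Y : IntMat} {M : LocalCoord p T (p * ε)}, colLattice Y = M.half → Y.det ≠ 0 := by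
    intro Y M hY h0
    have := natAbs_det_eq_index (by rw [M.half_index]; exact hp.ne_zero) hY
    rw [h0, M.half_index] at this
    exact hp.ne_zero this.symm
  have hStdet : ∀ i, |(St i).det| = |p * T.det| := fun i =>
    det_eq_of_genus hT.det_ne_zero (hSt i).1.det_ne_zero hTp (hStp i) (hStloc i)
  intro n _
  have hA := sum_rtilde hT hTh hTp hSt hStne hStp hStdet hStcomp
  have hA₁ := hA n
  have hA₂ := hA ((p : ℤ) ^ 2 * n)
  have hB₁ := sum_lamEq hT hTh hTp hSt hStne hStp hStdet hStcomp L hc₁ hG₁ (p * n)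
  have hB₂ := sum_lamEq hT hTh hTp hSt hStne hStp hStdet hStcomp L.swap hc₂ hG₂ (p * n)
  have hC := rEval_half_add hT L (hd hc₁) (hd hc₂) hc₁ hc₂ hG₁ hG₂
  have hC₁ := hC n
  have hC₂ := hC ((p : ℤ) ^ 2 * n)
  have e₁ : (p : ℤ) * (p ^ 2 * n) = p ^ 3 * n := by ring
  have e₂ : (p : ℤ) ^ 2 * (p * n) = p ^ 3 * n := by ring
  rw [e₁] at hA₂ hC₂
  rw [e₂] at hB₁ hB₂
  have hsum : (∑ i, ((rtilde p (St i) T : ℚ) / (autNum (St i) : ℚ))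
      * ((3 * (p : ℚ) / 2) * (rEval (St i) ((p : ℤ) * n) : ℚ)
        - ((p : ℚ) / ((p : ℚ) - 1)) * (rEval (St i) ((p : ℤ) ^ 3 * n) : ℚ))) =
      (3 * (p : ℚ) / 2) * ∑ i, (rtilde p (St i) T : ℚ) / autNum (St i) * rEval (St i) (p * n) -
        ((p : ℚ) / ((p : ℚ) - 1)) *
          ∑ i, (rtilde p (St i) T : ℚ) / autNum (St i) * rEval (St i) ((p : ℤ) ^ 3 * n) := by
    rw [Finset.mul_sum, Finset.mul_sum, ← Finset.sum_sub_distrib]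
    exact Finset.sum_congr rfl fun i _ => by ring
  have hp1 : (p : ℚ) - 1 ≠ 0 := sub_ne_zero.2 (by exact_mod_cast hp.ne_one)
  rw [hsum, hA₁, hA₂, hB₁, hB₂]
  field_simp
  linear_combination (-2 * (p : ℚ)) * hC₂ - ((p : ℚ) * (p - 1)) * hC₁
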